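/- Let G be a graph containing no jewel, no pyramid and no hole of length five, and let C be a shortest odd hole in G. Let X be a set of C-major vertices, and suppose there is a vertex x0 ∈ X that is nonadjacent to every other member of X. Then there is an X-heavy edge in C. -/

import Mathlib

/-!
Common definitions: holes, odd holes, C-major vertices, induced paths,
pyramids, jewels, candidates, x-gaps, gaps and normal sets.
A hole of length `n` is encoded as an injective map `f : ZMod n → V`
such that adjacency in `G` between vertices of the hole holds exactly
for consecutive indices (i.e. the hole is an induced cycle).
-/

variable {V : Type*}

/-- A hole: an induced cycle of length `n ≥ 4`. -/
def IsHole (G : SimpleGraph V) (n : ℕ) (f : ZMod n → V) : Prop :=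
  4 ≤ n ∧ Function.Injective f ∧
    ∀ i j : ZMod n, G.Adj (f i) (f j) ↔ (j = i + 1 ∨ i = j + 1)

/-- An odd hole. -/
def IsOddHole (G : SimpleGraph V) (n : ℕ) (f : ZMod n → V) : Prop :=
  IsHole G n f ∧ Odd n

/-- A shortest odd hole: an odd hole of minimum length among all odd holes. -/
def IsShortestOddHole (G : SimpleGraph V) (n : ℕ) (f : ZMod n → V) : Prop :=
  IsOddHole G n f ∧ ∀ (m : ℕ) (g : ZMod m → V), IsOddHole G m g → n ≤ m

/-- `G` has an odd hole. -/
def HasOddHole (G : SimpleGraph V) : Prop :=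
  ∃ (n : ℕ) (f : ZMod n → V), IsOddHole G n f

/-- A vertex `v` is `C`-major (for the hole given by `f`): `v` is not on the hole and
no three consecutive vertices of the hole contain all neighbours of `v` on the hole. -/
def IsCMajor (G : SimpleGraph V) {n : ℕ} (f : ZMod n → V) (v : V) : Prop :=
  v ∉ Set.range f ∧
    ∀ i : ZMod n, ∃ j : ZMod n, G.Adj v (f j) ∧ j ≠ i - 1 ∧ j ≠ i ∧ j ≠ i + 1

/-- An induced path of length `k`, encoded by its sequence of vertices:
adjacency holds exactly between consecutive vertices. -/
def IsInducedPathMap (G : SimpleGraph V) (k : ℕ) (p : Fin (k + 1) → V) : Prop :=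
  Function.Injective p ∧
    ∀ i j : Fin (k + 1), G.Adj (p i) (p j) ↔ (i.val + 1 = j.val ∨ j.val + 1 = i.val)

/-- A (not necessarily induced) path of length `k`, encoded by its sequence of vertices. -/
def IsPathMap (G : SimpleGraph V) (k : ℕ) (p : Fin (k + 1) → V) : Prop :=
  Function.Injective p ∧ ∀ i : Fin k, G.Adj (p i.castSucc) (p i.succ)

/-- A pyramid with apex `v0`, base `{v1, v2, v3}`, and paths `p1, p2, p3`
(of lengths `k1, k2, k3`) from `v0` to `v1, v2, v3` respectively. -/
def IsPyramid (G : SimpleGraph V) (v0 v1 v2 v3 : V) (k1 k2 k3 : ℕ)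
    (p1 : Fin (k1 + 1) → V) (p2 : Fin (k2 + 1) → V) (p3 : Fin (k3 + 1) → V) : Prop :=
  IsInducedPathMap G k1 p1 ∧ IsInducedPathMap G k2 p2 ∧ IsInducedPathMap G k3 p3 ∧
  p1 0 = v0 ∧ p2 0 = v0 ∧ p3 0 = v0 ∧
  p1 (Fin.last k1) = v1 ∧ p2 (Fin.last k2) = v2 ∧ p3 (Fin.last k3) = v3 ∧
  v1 ≠ v0 ∧ v2 ≠ v0 ∧ v3 ≠ v0 ∧
  G.Adj v1 v2 ∧ G.Adj v1 v3 ∧ G.Adj v2 v3 ∧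
  ((2 ≤ k1 ∧ 2 ≤ k2) ∨ (2 ≤ k1 ∧ 2 ≤ k3) ∨ (2 ≤ k2 ∧ 2 ≤ k3)) ∧
  (Set.range p1 ∩ Set.range p2 ⊆ {v0}) ∧
  (Set.range p1 ∩ Set.range p3 ⊆ {v0}) ∧
  (Set.range p2 ∩ Set.range p3 ⊆ {v0}) ∧
  (∀ u w : V, u ∈ Set.range p1 → w ∈ Set.range p2 → u ≠ v0 → w ≠ v0 →
    G.Adj u w → u = v1 ∧ w = v2) ∧
  (∀ u w : V, u ∈ Set.range p1 → w ∈ Set.range p3 → u ≠ v0 → w ≠ v0 →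
    G.Adj u w → u = v1 ∧ w = v3) ∧
  (∀ u w : V, u ∈ Set.range p2 → w ∈ Set.range p3 → u ≠ v0 → w ≠ v0 →
    G.Adj u w → u = v2 ∧ w = v3)

/-- `G` contains a pyramid. -/
def ContainsPyramid (G : SimpleGraph V) : Prop :=
  ∃ (v0 v1 v2 v3 : V) (k1 k2 k3 : ℕ) (p1 : Fin (k1 + 1) → V)
    (p2 : Fin (k2 + 1) → V) (p3 : Fin (k3 + 1) → V),
    IsPyramid G v0 v1 v2 v3 k1 k2 k3 p1 p2 p3

/-- A jewel on vertices `v1, …, v5` together with the path `p` (of length `k`)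
from `v1` to `v4`. -/
def IsJewel (G : SimpleGraph V) (v1 v2 v3 v4 v5 : V) (k : ℕ)
    (p : Fin (k + 1) → V) : Prop :=
  List.Pairwise Ne [v1, v2, v3, v4, v5] ∧
  G.Adj v1 v2 ∧ G.Adj v2 v3 ∧ G.Adj v3 v4 ∧ G.Adj v4 v5 ∧ G.Adj v5 v1 ∧
  ¬ G.Adj v1 v3 ∧ ¬ G.Adj v2 v4 ∧ ¬ G.Adj v1 v4 ∧
  IsInducedPathMap G k p ∧ p 0 = v1 ∧ p (Fin.last k) = v4 ∧
  ∀ i : Fin (k + 1), i ≠ 0 → i ≠ Fin.last k →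
    ¬ G.Adj v2 (p i) ∧ ¬ G.Adj v3 (p i) ∧ ¬ G.Adj v5 (p i)

/-- `G` contains a jewel. -/
def ContainsJewel (G : SimpleGraph V) : Prop :=
  ∃ (v1 v2 v3 v4 v5 : V) (k : ℕ) (p : Fin (k + 1) → V),
    IsJewel G v1 v2 v3 v4 v5 k p

/-- A candidate: a graph with no jewel, no pyramid, and no heavy-cleanable shortest
odd hole (a shortest odd hole is heavy-cleanable if some edge of it has the property
that every major vertex is adjacent to one of its ends). -/
def Candidate (G : SimpleGraph V) : Prop :=
  ¬ ContainsJewel G ∧ ¬ ContainsPyramid G ∧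
  ¬ ∃ (n : ℕ) (f : ZMod n → V) (i : ZMod n), IsShortestOddHole G n f ∧
      ∀ v : V, IsCMajor G f v → (G.Adj v (f i) ∨ G.Adj v (f (i + 1)))

/-- An `x`-gap of a hole `f : ZMod n → V`: an induced path of the hole, of length
`ℓ ≥ 2`, starting at index `a` and ending at index `a + ℓ`, whose ends are adjacent
to `x` and whose internal vertices are nonadjacent to `x`. (The condition `ℓ + 2 ≤ n`
says that the arc is an induced path of the hole.) -/
def IsXGap (G : SimpleGraph V) {n : ℕ} (f : ZMod n → V) (x : V) (a : ZMod n)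
    (ℓ : ℕ) : Prop :=
  2 ≤ ℓ ∧ ℓ + 2 ≤ n ∧ G.Adj x (f a) ∧ G.Adj x (f (a + (ℓ : ZMod n))) ∧
    ∀ t : ℕ, 0 < t → t < ℓ → ¬ G.Adj x (f (a + (t : ZMod n)))

/-- `ℓ` is the length of an `A`-gap of the cycle on `ZMod n` (with `A ⊆ ZMod n`):
either `A = ∅` and the gap is the whole cycle, or the gap runs from some `i ∈ A`
to `i + ℓ ∈ A` with no internal vertex in `A`. -/
def IsGapLength (n : ℕ) (A : Set (ZMod n)) (ℓ : ℕ) : Prop :=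
  (A = ∅ ∧ ℓ = n) ∨
  (2 ≤ ℓ ∧ ℓ ≤ n ∧ ∃ i ∈ A, (i + (ℓ : ZMod n)) ∈ A ∧
    ∀ t : ℕ, 0 < t → t < ℓ → (i + (t : ZMod n)) ∉ A)

/-- `A` is normal in the cycle on `ZMod n`: every `A`-gap has even length. -/
def NormalInCycle (n : ℕ) (A : Set (ZMod n)) : Prop :=
  ∀ ℓ : ℕ, IsGapLength n A ℓ → Even ℓ

section Parametrisation

/-- A parametrisation by the integers of a shortest odd hole of length at least seven. -/
structure IntHole (G : SimpleGraph V) (n : ℕ) (F : ℤ → V) : Prop where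
  seven : 7 ≤ n
  odd : Odd n
  periodic : ∀ i, F (i + n) = F i
  adj : ∀ i j : ℤ, i < j → j < i + n → (G.Adj (F i) (F j) ↔ j = i + 1 ∨ j = i + n - 1)
  inj : ∀ i j : ℤ, i < j → j < i + n → F i ≠ F j
  shortest : ∀ (m : ℕ) (g : ZMod m → V), IsOddHole G m g → n ≤ m

variable {G : SimpleGraph V} {n : ℕ} {F : ℤ → V} {x y : V}

theorem IntHole.neg (hF : IntHole G n F) : IntHole G n (fun i => F (-i)) where
  seven := hF.seven
  odd := hF.odd
  periodic i := by
    have := hF.periodic (-(i + n))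
    rw [← this]; congr 1; ring
  adj i j h1 h2 := by
    rw [G.adj_comm, hF.adj (-j) (-i) (by omega) (by omega)]
    omega
  inj i j h1 h2 := (hF.inj (-j) (-i) (by omega) (by omega)).symm
  shortest := hF.shortest

theorem IntHole.adj_iff (hF : IntHole G n F) {i j : ℤ} (h1 : j ≤ i + n - 2)
    (h2 : i ≤ j + n - 2) : G.Adj (F i) (F j) ↔ (j = i + 1 ∨ i = j + 1) := by
  have := hF.seven
  rcases lt_trichotomy i j with h | h | h
  · rw [hF.adj i j h (by omega)]; omega
  · subst h; simp
  · rw [G.adj_comm, hF.adj j i h (by omega)]; omega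

theorem IntHole.ne (hF : IntHole G n F) {i j : ℤ} (h : i ≠ j) (h1 : j < i + n)
    (h2 : i < j + n) : F i ≠ F j := by
  rcases lt_or_gt_of_ne h with h | h
  · exact hF.inj i j h h1
  · exact (hF.inj j i h h2).symm

/-- A sequence whose adjacencies are those of a cycle of length `m` is a hole. -/
theorem isHole_of_seq (h : ℕ → V) (m : ℕ) (hm : 4 ≤ m)
    (hinj : ∀ i j, i < j → j < m → h i ≠ h j)
    (hadj : ∀ i j, i < j → j < m → (G.Adj (h i) (h j) ↔ j = i + 1 ∨ (i = 0 ∧ j + 1 = m))) :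
    IsHole G m (fun z => h z.val) := by
  have : NeZero m := ⟨by omega⟩
  have succ_iff (i j : ZMod m) :
      j = i + 1 ↔ (j.val = i.val + 1 ∨ (j.val = 0 ∧ i.val + 1 = m)) := by
    have hi := ZMod.val_lt i
    have hj := ZMod.val_lt j
    have e : j = i + 1 ↔ ((j.val : ℕ) : ZMod m) = ((i.val + 1 : ℕ) : ZMod m) := by
      push_cast; simp
    rw [e, ZMod.natCast_eq_natCast_iff', Nat.mod_eq_of_lt hj]
    rcases Nat.lt_or_ge (i.val + 1) m with h | h
    · rw [Nat.mod_eq_of_lt h]; omega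
    · have : i.val + 1 = m := by omega
      rw [this, Nat.mod_self]; omega
  refine ⟨hm, ?_, ?_⟩
  · intro i j hij
    by_contra hne
    have hv : i.val ≠ j.val := fun h => hne (ZMod.val_injective m h)
    rcases lt_or_gt_of_ne hv with hlt | hlt
    · exact hinj _ _ hlt (ZMod.val_lt j) hij
    · exact hinj _ _ hlt (ZMod.val_lt i) hij.symm
  · intro i j
    rw [succ_iff, succ_iff]
    have hi := ZMod.val_lt i
    have hj := ZMod.val_lt j
    rcases lt_trichotomy i.val j.val with hlt | heq | hlt
    · simp only
      rw [hadj _ _ hlt hj]; omega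
    · simp only [heq, SimpleGraph.irrefl, false_iff]; omega
    · simp only
      rw [G.adj_comm, hadj _ _ hlt hi]; omega

/-- The first `k + 1` terms of `h` are the vertices of an induced path, in order. -/
def SeqPath (G : SimpleGraph V) (h : ℕ → V) (k : ℕ) : Prop :=
  ∀ s t, s < t → t ≤ k → h s ≠ h t ∧ (G.Adj (h s) (h t) ↔ t = s + 1)

/-- The sequence consisting of the first `k + 1` terms of `h` followed by `g`. -/
def seqAppend (h : ℕ → V) (k : ℕ) (g : ℕ → V) (t : ℕ) : V :=
  if t ≤ k then h t else g (t - (k + 1))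

theorem seqAppend_of_le {h g : ℕ → V} {k t : ℕ} (ht : t ≤ k) : seqAppend h k g t = h t :=
  if_pos ht

theorem seqAppend_of_lt {h g : ℕ → V} {k t : ℕ} (ht : k < t) :
    seqAppend h k g t = g (t - (k + 1)) :=
  if_neg (by omega)

theorem seqPath_const (v : V) : SeqPath G (fun _ => v) 0 := by
  intro s t h1 h2
  omega

theorem SeqPath.append {h g : ℕ → V} {k l : ℕ} (hh : SeqPath G h k) (hg : SeqPath G g l)
    (hcross : ∀ s t, s ≤ k → t ≤ l → h s ≠ g t ∧ (G.Adj (h s) (g t) ↔ s = k ∧ t = 0)) :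
    SeqPath G (seqAppend h k g) (k + l + 1) := by
  intro s t hst ht
  rcases Nat.lt_or_ge k s with h1 | h1
  · rw [seqAppend_of_lt h1, seqAppend_of_lt (by omega)]
    obtain ⟨h2, h3⟩ := hg (s - (k + 1)) (t - (k + 1)) (by omega) (by omega)
    exact ⟨h2, by rw [h3]; omega⟩
  · rw [seqAppend_of_le h1]
    rcases Nat.lt_or_ge k t with h4 | h4
    · rw [seqAppend_of_lt h4]
      obtain ⟨h2, h3⟩ := hcross s (t - (k + 1)) h1 (by omega)
      exact ⟨h2, by rw [h3]; omega⟩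
    · rw [seqAppend_of_le h4]
      exact hh s t hst h4

theorem SeqPath.isInducedPathMap {h : ℕ → V} {k : ℕ} (hh : SeqPath G h k) :
    IsInducedPathMap G k (fun t => h t.val) := by
  refine ⟨?_, ?_⟩
  · intro i j hij
    by_contra hne
    have hv : i.val ≠ j.val := fun h => hne (Fin.ext h)
    rcases lt_or_gt_of_ne hv with hlt | hlt
    · exact (hh _ _ hlt (by omega)).1 hij
    · exact (hh _ _ hlt (by omega)).1 hij.symm
  · intro i j
    rcases lt_trichotomy i.val j.val with hlt | heq | hlt
    · simp only
      rw [(hh _ _ hlt (by omega)).2]; omega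
    · simp only [heq, SimpleGraph.irrefl, false_iff]; omega
    · simp only
      rw [G.adj_comm, (hh _ _ hlt (by omega)).2]; omega

/-- An induced path and a vertex adjacent to exactly its two ends form a hole. -/
theorem SeqPath.exists_isHole {h : ℕ → V} {k : ℕ} (hh : SeqPath G h k) (hk : 2 ≤ k) (z : V)
    (hz : ∀ s, s ≤ k → h s ≠ z ∧ (G.Adj z (h s) ↔ s = 0 ∨ s = k)) :
    ∃ g, IsHole G (k + 2) g := by
  refine ⟨_, isHole_of_seq (seqAppend h k fun _ => z) (k + 2) (by omega) ?_ ?_⟩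
  · intro s t hst ht
    rw [seqAppend_of_le (by omega : s ≤ k)]
    rcases Nat.lt_or_ge k t with h4 | h4
    · rw [seqAppend_of_lt h4]
      exact (hz s (by omega)).1
    · rw [seqAppend_of_le h4]
      exact (hh s t hst h4).1
  · intro s t hst ht
    rw [seqAppend_of_le (by omega : s ≤ k)]
    rcases Nat.lt_or_ge k t with h4 | h4
    · rw [seqAppend_of_lt h4, G.adj_comm, (hz s (by omega)).2]
      omega
    · rw [seqAppend_of_le h4, (hh s t hst h4).2]
      omega

/-- Three induced paths with a common origin whose only further contacts are between their
last vertices form a pyramid. -/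
theorem containsPyramid_of_seqPath {h₁ h₂ h₃ : ℕ → V} {k₁ k₂ k₃ : ℕ}
    (H₁ : SeqPath G h₁ k₁) (H₂ : SeqPath G h₂ k₂) (H₃ : SeqPath G h₃ k₃)
    (l₁ : 1 ≤ k₁) (l₂ : 2 ≤ k₂) (l₃ : 2 ≤ k₃) (e₂ : h₂ 0 = h₁ 0) (e₃ : h₃ 0 = h₁ 0)
    (H₁₂ : ∀ s t, 1 ≤ s → s ≤ k₁ → 1 ≤ t → t ≤ k₂ →
      h₁ s ≠ h₂ t ∧ (G.Adj (h₁ s) (h₂ t) ↔ s = k₁ ∧ t = k₂))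
    (H₁₃ : ∀ s t, 1 ≤ s → s ≤ k₁ → 1 ≤ t → t ≤ k₃ →
      h₁ s ≠ h₃ t ∧ (G.Adj (h₁ s) (h₃ t) ↔ s = k₁ ∧ t = k₃))
    (H₂₃ : ∀ s t, 1 ≤ s → s ≤ k₂ → 1 ≤ t → t ≤ k₃ →
      h₂ s ≠ h₃ t ∧ (G.Adj (h₂ s) (h₃ t) ↔ s = k₂ ∧ t = k₃)) :
    ContainsPyramid G := by
  have meet {h h' : ℕ → V} {k k' : ℕ} (e : h' 0 = h 0)
      (H : ∀ s t, 1 ≤ s → s ≤ k → 1 ≤ t → t ≤ k' →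
        h s ≠ h' t ∧ (G.Adj (h s) (h' t) ↔ s = k ∧ t = k')) :
      Set.range (fun t : Fin (k + 1) => h t.val) ∩
        Set.range (fun t : Fin (k' + 1) => h' t.val) ⊆ {h 0} := by
    rintro v ⟨⟨s, rfl⟩, ⟨t, ht⟩⟩
    simp only [Set.mem_singleton_iff] at ht ⊢
    rcases Nat.eq_zero_or_pos s.val with hs | hs
    · rw [hs]
    · rcases Nat.eq_zero_or_pos t.val with ht' | ht'
      · rw [← ht, ht', e]
      · exact absurd ht.symm (H s t hs (by omega) ht' (by omega)).1
  have contact {h h' : ℕ → V} {k k' : ℕ} (e : h' 0 = h 0)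
      (H : ∀ s t, 1 ≤ s → s ≤ k → 1 ≤ t → t ≤ k' →
        h s ≠ h' t ∧ (G.Adj (h s) (h' t) ↔ s = k ∧ t = k')) :
      ∀ u w : V, u ∈ Set.range (fun t : Fin (k + 1) => h t.val) →
        w ∈ Set.range (fun t : Fin (k' + 1) => h' t.val) → u ≠ h 0 → w ≠ h 0 →
        G.Adj u w → u = h k ∧ w = h' k' := by
    rintro u w ⟨s, rfl⟩ ⟨t, rfl⟩ hu hw hadj
    beta_reduce at hu hw
    have hs : 1 ≤ s.val := by
      by_contra hs
      exact hu (by rw [show s.val = 0 by omega])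
    have ht : 1 ≤ t.val := by
      by_contra ht
      exact hw (by rw [show t.val = 0 by omega, e])
    obtain ⟨h1, h2⟩ := ((H s t hs (by omega) ht (by omega)).2).1 hadj
    exact ⟨by simp only [h1], by simp only [h2]⟩
  refine ⟨h₁ 0, h₁ k₁, h₂ k₂, h₃ k₃, k₁, k₂, k₃, _, _, _,
    H₁.isInducedPathMap, H₂.isInducedPathMap, H₃.isInducedPathMap, rfl, e₂, e₃, rfl, rfl, rfl,
    (H₁ 0 k₁ l₁ le_rfl).1.symm, ?_, ?_, ?_, ?_, ?_, Or.inr (Or.inr ⟨l₂, l₃⟩),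
    meet e₂ H₁₂, meet e₃ H₁₃, ?_, contact e₂ H₁₂, contact e₃ H₁₃, ?_⟩
  · rw [← e₂]; exact (H₂ 0 k₂ (by omega) le_rfl).1.symm
  · rw [← e₃]; exact (H₃ 0 k₃ (by omega) le_rfl).1.symm
  · exact ((H₁₂ k₁ k₂ l₁ le_rfl (by omega) le_rfl).2).2 ⟨rfl, rfl⟩
  · exact ((H₁₃ k₁ k₃ l₁ le_rfl (by omega) le_rfl).2).2 ⟨rfl, rfl⟩
  · exact ((H₂₃ k₂ k₃ (by omega) le_rfl (by omega) le_rfl).2).2 ⟨rfl, rfl⟩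
  · rw [← e₂]; exact meet (e₃.trans e₂.symm) H₂₃
  · rw [← e₂]; exact contact (e₃.trans e₂.symm) H₂₃

theorem IntHole.seqPath (hF : IntHole G n F) (s ε : ℤ) (hε : ε = 1 ∨ ε = -1) (k : ℕ)
    (hk : k + 2 ≤ n) : SeqPath G (fun t => F (s + ε * t)) k := by
  intro t u htu hu
  rcases hε with rfl | rfl
  · exact ⟨hF.ne (by omega) (by omega) (by omega),
      by rw [hF.adj_iff (by omega) (by omega)]; omega⟩
  · exact ⟨hF.ne (by omega) (by omega) (by omega),
      by rw [hF.adj_iff (by omega) (by omega)]; omega⟩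

/-- `x` lies off the hole and its neighbours are not contained in three consecutive vertices. -/
structure IntMajor (G : SimpleGraph V) (n : ℕ) (F : ℤ → V) (x : V) : Prop where
  notMem : ∀ i, F i ≠ x
  spread : ∀ i : ℤ, ∃ j, i + 2 ≤ j ∧ j ≤ i + n - 2 ∧ G.Adj x (F j)

theorem IntMajor.neg (hx : IntMajor G n F x) :
    IntMajor G n (fun i => F (-i)) x where
  notMem i := hx.notMem _
  spread i := by
    obtain ⟨j, h1, h2, h3⟩ := hx.spread (-i - n)
    refine ⟨-j, by omega, by omega, by simpa using h3⟩

/-- Consecutive neighbours of a major vertex on the hole, if not adjacent, are at even distance. -/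
theorem IntMajor.even_gap (hF : IntHole G n F) (hx : IntMajor G n F x) (i j : ℤ)
    (hij : i + 2 ≤ j) (hi : G.Adj x (F i)) (hj : G.Adj x (F j))
    (hgap : ∀ k, i < k → k < j → ¬ G.Adj x (F k)) : Even (j - i) := by
  have h7 := hF.seven
  have hlen : j + 3 ≤ i + n := by
    obtain ⟨k, h1, h2, h3⟩ := hx.spread (i - 1)
    by_contra hcon
    exact hgap k (by omega) (by omega) h3
  by_contra hodd
  rw [Int.not_even_iff_odd] at hodd
  obtain ⟨ℓ, hℓ⟩ : ∃ ℓ : ℕ, j - i = ℓ := ⟨(j - i).toNat, by omega⟩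
  obtain rfl : j = i + ℓ := by omega
  obtain ⟨g, hole⟩ := (hF.seqPath i 1 (Or.inl rfl) ℓ (by omega)).exists_isHole (by omega) x (by
    intro s hs
    refine ⟨hx.notMem _, ?_⟩
    rw [one_mul]
    rcases Nat.eq_zero_or_pos s with rfl | h0
    · simpa using hi
    · rcases eq_or_lt_of_le hs with rfl | h3
      · simpa using hj
      · have := hgap (i + s) (by omega) (by omega)
        simp only [this, false_iff]; omega)
  have := hF.shortest _ _ ⟨hole, by
    rw [add_sub_cancel_left] at hodd
    have : Odd ℓ := by exact_mod_cast hodd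
    exact this.add_even even_two⟩
  omega

/-- A vertex off the hole whose neighbours there are two consecutive vertices and one more vertex
adjacent to neither gives a pyramid. -/
theorem IntMajor.not_three (hP : ¬ ContainsPyramid G) (hF : IntHole G n F)
    (hx : IntMajor G n F x) (i j : ℤ) (hi : G.Adj x (F i)) (hi' : G.Adj x (F (i + 1)))
    (hj : G.Adj x (F j)) (h1 : i + 3 ≤ j) (h2 : j + 2 ≤ i + n)
    (honly : ∀ k, i + 2 ≤ k → k < i + n → k ≠ j → ¬ G.Adj x (F k)) : False := by
  have h7 := hF.seven
  obtain ⟨p, hp⟩ : ∃ p : ℕ, j = i + 1 + p := ⟨(j - i - 1).toNat, by omega⟩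
  obtain ⟨q, hq⟩ : ∃ q : ℕ, i + n = j + q := ⟨(i + n - j).toNat, by omega⟩
  refine hP (containsPyramid_of_seqPath (h₁ := seqAppend (fun _ => F j) 0 fun _ => x)
    (k₁ := 1) (k₂ := p) (k₃ := q)
    ((seqPath_const (F j)).append (seqPath_const x) ?_)
    (hF.seqPath j (-1) (Or.inr rfl) p (by omega)) (hF.seqPath j 1 (Or.inl rfl) q (by omega))
    le_rfl (by omega) (by omega) (by simp [seqAppend]) (by simp [seqAppend]) ?_ ?_ ?_)
  · intro s t hs ht
    obtain rfl : s = 0 := by omega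
    obtain rfl : t = 0 := by omega
    exact ⟨hx.notMem _, by simpa using hj.symm⟩
  · intro s t hs hs' ht ht'
    obtain rfl : s = 1 := by omega
    rw [seqAppend_of_lt (by omega)]
    refine ⟨(hx.notMem _).symm, ?_⟩
    rcases eq_or_lt_of_le ht' with rfl | ht'
    · simpa [hp] using hi'
    · have := honly (j + -1 * t) (by omega) (by omega) (by omega)
      simp only [this, false_iff]; omega
  · intro s t hs hs' ht ht'
    obtain rfl : s = 1 := by omega
    rw [seqAppend_of_lt (by omega)]
    refine ⟨(hx.notMem _).symm, ?_⟩
    rcases eq_or_lt_of_le ht' with rfl | ht'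
    · simpa [← hq, hF.periodic] using hi
    · have := honly (j + 1 * t) (by omega) (by omega) (by omega)
      simp only [this, false_iff]; omega
  · intro s t hs hs' ht ht'
    refine ⟨hF.ne (by omega) (by omega) (by omega), ?_⟩
    rw [hF.adj (j + -1 * s) (j + 1 * t) (by omega) (by omega)]
    omega

/-- A vertex off the hole whose neighbours there lie in four consecutive vertices, and which is
adjacent to the two extreme ones, gives a jewel. -/
theorem IntMajor.not_four (hJ : ¬ ContainsJewel G) (hF : IntHole G n F)
    (hx : IntMajor G n F x) (i : ℤ) (hi : G.Adj x (F i)) (hi' : G.Adj x (F (i + 3)))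
    (honly : ∀ k, i + 4 ≤ k → k < i + n → ¬ G.Adj x (F k)) : False := by
  have h7 := hF.seven
  obtain ⟨p, hp⟩ : ∃ p : ℕ, i + n = i + 3 + p := ⟨(n - 3 : ℤ).toNat, by omega⟩
  have hend : F (i + 3 + p) = F i := by rw [← hp, hF.periodic]
  refine hJ ⟨F (i + 3), F (i + 2), F (i + 1), F i, x, p, _, ?_,
    (hF.adj_iff (by omega) (by omega)).2 (by omega),
    (hF.adj_iff (by omega) (by omega)).2 (by omega),
    (hF.adj_iff (by omega) (by omega)).2 (by omega), hi.symm, hi',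
    fun h => absurd ((hF.adj_iff (by omega) (by omega)).1 h) (by omega),
    fun h => absurd ((hF.adj_iff (by omega) (by omega)).1 h) (by omega),
    fun h => absurd ((hF.adj_iff (by omega) (by omega)).1 h) (by omega),
    (hF.seqPath (i + 3) 1 (Or.inl rfl) p (by omega)).isInducedPathMap, by simp,
    by simpa using hend, ?_⟩
  · have hne (s t : ℤ) (h1 : t < s) (h2 : s < t + n) : F s ≠ F t :=
      hF.ne (by omega) (by omega) (by omega)
    simp only [List.pairwise_cons, List.mem_cons, List.not_mem_nil, or_false, forall_eq_or_imp,
      forall_eq, ne_eq, false_imp_iff, implies_true, List.Pairwise.nil, and_true]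
    exact ⟨⟨hne _ _ (by omega) (by omega), hne _ _ (by omega) (by omega),
      hne _ _ (by omega) (by omega), hx.notMem _⟩,
      ⟨hne _ _ (by omega) (by omega), hne _ _ (by omega) (by omega), hx.notMem _⟩,
      ⟨hne _ _ (by omega) (by omega), hx.notMem _⟩, hx.notMem _⟩
  · intro t h0 hl
    have ht0 : t.val ≠ 0 := fun h => h0 (Fin.ext h)
    have htl : t.val ≠ p := fun h => hl (Fin.ext h)
    have := t.isLt
    rw [hF.adj (i + 2) _ (by omega) (by omega), hF.adj (i + 1) _ (by omega) (by omega)]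
    exact ⟨by omega, by omega, honly _ (by omega) (by omega)⟩

/-- Two arcs of the hole far from each other, each joining a neighbour of `x` to a neighbour of
`y`, form a hole together with `x` and `y`. -/
theorem IntHole.exists_isHole_of_arcs (hF : IntHole G n F) (hx : IntMajor G n F x)
    (hy : IntMajor G n F y) (hne : x ≠ y) (hxy : ¬ G.Adj x y) (i s ε : ℤ) (p q : ℕ)
    (hε : ε = 1 ∨ ε = -1)
    (hPx : ∀ t : ℕ, t ≤ p → (G.Adj x (F (i + t)) ↔ t = 0))
    (hPy : ∀ t : ℕ, t ≤ p → (G.Adj y (F (i + t)) ↔ t = p))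
    (hQx : ∀ t : ℕ, t ≤ q → (G.Adj x (F (s + ε * t)) ↔ t = q))
    (hQy : ∀ t : ℕ, t ≤ q → (G.Adj y (F (s + ε * t)) ↔ t = 0))
    (hfar : ∀ t : ℕ, t ≤ q → i + p + 2 ≤ s + ε * t ∧ s + ε * t + 2 ≤ i + n) :
    ∃ g, IsHole G (p + q + 4) g := by
  have h0 := hfar 0 (by omega)
  have hq := hfar q le_rfl
  have hqn : q + 2 ≤ n := by rcases hε with rfl | rfl <;> omega
  have H₁ := (hF.seqPath i 1 (Or.inl rfl) p (by omega)).append (seqPath_const y) (by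
    intro t u ht hu
    rw [one_mul, G.adj_comm, hPy t ht]
    exact ⟨hy.notMem _, by omega⟩)
  have H₂ := H₁.append (hF.seqPath s ε hε q hqn) (by
    intro t u ht hu
    have hu' := hfar u hu
    rcases Nat.lt_or_ge p t with h | h
    · rw [seqAppend_of_lt h, hQy u hu]
      exact ⟨(hy.notMem _).symm, by omega⟩
    · rw [seqAppend_of_le h]
      refine ⟨hF.ne (by omega) (by omega) (by omega), ?_⟩
      rw [hF.adj_iff (by omega) (by omega)]
      omega)
  have hole := H₂.exists_isHole (by omega) x (by
    intro t ht
    rcases Nat.lt_or_ge (p + 0 + 1) t with h | h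
    · rw [seqAppend_of_lt h, hQx _ (by omega)]
      exact ⟨hx.notMem _, by omega⟩
    · rw [seqAppend_of_le h]
      rcases Nat.lt_or_ge p t with h' | h'
      · rw [seqAppend_of_lt h']
        exact ⟨hne.symm, by simp only [hxy, false_iff]; omega⟩
      · rw [seqAppend_of_le h', one_mul, hPx t h']
        exact ⟨hx.notMem _, by omega⟩)
  have e : p + 0 + 1 + q + 1 + 2 = p + q + 4 := by omega
  rwa [e] at hole

/-- Two arcs of the hole, each joining a neighbour of `x` to a neighbour of `y`, and a common
neighbour of `x` and `y` adjacent to the `x`-end of the first arc and far from the second arc,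
form a pyramid together with `x` and `y`. -/
theorem IntHole.containsPyramid_of_arcs (hF : IntHole G n F) (hx : IntMajor G n F x)
    (hy : IntMajor G n F y) (hne : x ≠ y) (hxy : ¬ G.Adj x y) (i s ε : ℤ) (p q : ℕ)
    (hε : ε = 1 ∨ ε = -1) (hp : 1 ≤ p)
    (hvx : G.Adj x (F (i - 1))) (hvy : G.Adj y (F (i - 1)))
    (hPx : ∀ t : ℕ, t ≤ p → (G.Adj x (F (i + t)) ↔ t = 0))
    (hPy : ∀ t : ℕ, t ≤ p → (G.Adj y (F (i + t)) ↔ t = p))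
    (hQx : ∀ t : ℕ, t ≤ q → (G.Adj x (F (s + ε * t)) ↔ t = q))
    (hQy : ∀ t : ℕ, t ≤ q → (G.Adj y (F (s + ε * t)) ↔ t = 0))
    (hfar : ∀ t : ℕ, t ≤ q → i + p + 2 ≤ s + ε * t ∧ s + ε * t + 3 ≤ i + n) :
    ContainsPyramid G := by
  have h0 := hfar 0 (by omega)
  have hq := hfar q le_rfl
  have hqn : q + 2 ≤ n := by rcases hε with rfl | rfl <;> omega
  have hback (t : ℕ) (ht : t ≤ p) : i + p + -1 * t = i + (p - t : ℕ) := by omega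
  have H₁ := (seqPath_const y).append (seqPath_const (F (i - 1))) (G := G) (by
    intro t u ht hu
    exact ⟨(hy.notMem _).symm, by simp only [hvy, true_iff]; omega⟩)
  have H₂ := (seqPath_const y).append (hF.seqPath (i + p) (-1) (Or.inr rfl) p (by omega)) (by
    intro t u ht hu
    refine ⟨(hy.notMem _).symm, ?_⟩
    rw [hback u hu, hPy _ (by omega)]; omega)
  have H₃ := ((seqPath_const y).append (hF.seqPath s ε hε q hqn) (by
    intro t u ht hu
    refine ⟨(hy.notMem _).symm, ?_⟩
    rw [hQy u hu]; omega)).append (seqPath_const x) (by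
    intro t u ht hu
    rcases Nat.lt_or_ge 0 t with h | h
    · rw [seqAppend_of_lt h, G.adj_comm, hQx _ (by omega)]
      exact ⟨hx.notMem _, by omega⟩
    · rw [seqAppend_of_le h, G.adj_comm]
      exact ⟨hne.symm, by simp only [hxy, false_iff]; omega⟩)
  refine containsPyramid_of_seqPath H₁ H₂ H₃ (by omega) (by omega) (by omega)
    (by simp [seqAppend]) (by simp [seqAppend]) ?_ ?_ ?_
  · intro t u ht ht' hu hu'
    rw [seqAppend_of_lt (by omega), seqAppend_of_lt (by omega), hback _ (by omega)]
    refine ⟨hF.ne (by omega) (by omega) (by omega), ?_⟩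
    rw [hF.adj_iff (by omega) (by omega)]
    omega
  · intro t u ht ht' hu hu'
    rw [seqAppend_of_lt (by omega)]
    rcases Nat.lt_or_ge (0 + q + 1) u with h | h
    · rw [seqAppend_of_lt h, G.adj_comm]
      exact ⟨hx.notMem _, by simp only [hvx, true_iff]; omega⟩
    · rw [seqAppend_of_le h, seqAppend_of_lt (by omega)]
      have := hfar (u - (0 + 1)) (by omega)
      refine ⟨hF.ne (by omega) (by omega) (by omega), ?_⟩
      rw [hF.adj_iff (by omega) (by omega)]
      omega
  · intro t u ht ht' hu hu'
    rw [seqAppend_of_lt (by omega), hback _ (by omega)]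
    rcases Nat.lt_or_ge (0 + q + 1) u with h | h
    · rw [seqAppend_of_lt h, G.adj_comm, hPx _ (by omega)]
      exact ⟨hx.notMem _, by omega⟩
    · rw [seqAppend_of_le h, seqAppend_of_lt (by omega)]
      have := hfar (u - (0 + 1)) (by omega)
      refine ⟨hF.ne (by omega) (by omega) (by omega), ?_⟩
      rw [hF.adj_iff (by omega) (by omega)]
      omega

end Parametrisation

section CyclicSums

theorem exists_last (P : ℤ → Prop) {i j : ℤ} (hij : i ≤ j) (hi : P i) :
    ∃ k, i ≤ k ∧ k ≤ j ∧ P k ∧ ∀ m, k < m → m ≤ j → ¬ P m := by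
  obtain ⟨k, ⟨h1, h2⟩, h3⟩ := Int.exists_greatest_of_bdd (P := fun z => z ≤ j ∧ P z)
    ⟨j, fun z hz => hz.1⟩ ⟨i, hij, hi⟩
  exact ⟨k, h3 i ⟨hij, hi⟩, h1, h2, fun m hm hmj hP => absurd (h3 m ⟨hmj, hP⟩) (by omega)⟩

theorem exists_first (P : ℤ → Prop) {i j : ℤ} (hij : i ≤ j) (hj : P j) :
    ∃ k, i ≤ k ∧ k ≤ j ∧ P k ∧ ∀ m, i ≤ m → m < k → ¬ P m := by
  obtain ⟨k, ⟨h1, h2⟩, h3⟩ := Int.exists_least_of_bdd (P := fun z => i ≤ z ∧ P z)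
    ⟨i, fun z hz => hz.1⟩ ⟨j, hij, hj⟩
  exact ⟨k, h1, h3 j ⟨hij, hj⟩, h2, fun m hm hmj hP => absurd (h3 m ⟨hm, hP⟩) (by omega)⟩

theorem sum_Ico_add_sum_Ico (c : ℤ → ZMod 2) {i j k : ℤ} (hij : i ≤ j) (hjk : j ≤ k) :
    ∑ t ∈ Finset.Ico i j, c t + ∑ t ∈ Finset.Ico j k, c t = ∑ t ∈ Finset.Ico i k, c t := by
  rw [← Finset.sum_union (Finset.Ico_disjoint_Ico_consecutive i j k),
    Finset.Ico_union_Ico_eq_Ico hij hjk]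

theorem sum_Ico_self_succ (c : ℤ → ZMod 2) (i : ℤ) : ∑ t ∈ Finset.Ico i (i + 1), c t = c i := by
  have : Finset.Ico i (i + 1) = {i} := by
    ext t
    simp only [Finset.mem_Ico, Finset.mem_singleton]
    omega
  rw [this, Finset.sum_singleton]

theorem sum_Ico_period_eq {n : ℕ} {c : ℤ → ZMod 2} (hc : ∀ i, c (i + n) = c i) (i j : ℤ) :
    ∑ t ∈ Finset.Ico i (i + n), c t = ∑ t ∈ Finset.Ico j (j + n), c t := by
  have succ (i : ℤ) : ∑ t ∈ Finset.Ico i (i + n), c t =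
      ∑ t ∈ Finset.Ico (i + 1) (i + 1 + n), c t := by
    have h1 := sum_Ico_add_sum_Ico c (show i ≤ i + 1 by omega) (show i + 1 ≤ i + 1 + n by omega)
    have h2 := sum_Ico_add_sum_Ico c (show i ≤ i + n by omega)
      (show i + (n : ℤ) ≤ i + n + 1 by omega)
    rw [sum_Ico_self_succ] at h1 h2
    rw [show i + 1 + (n : ℤ) = i + n + 1 by ring] at h1 ⊢
    rw [← h1, hc, add_comm] at h2
    exact add_left_cancel h2
  have zero (i : ℤ) : ∑ t ∈ Finset.Ico i (i + n), c t = ∑ t ∈ Finset.Ico (0 : ℤ) (0 + n), c t := by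
    induction i with
    | zero => rfl
    | succ i ih => rw [← succ, ih]
    | pred i ih => rw [succ, sub_add_cancel, ih]
  rw [zero i, zero j]

/-- If the weight between any two consecutive members of `U` agrees modulo two with their
distance, then so does the weight between any two members of `U`. -/
theorem sum_Ico_eq_of_consecutive (U : ℤ → Prop) (c : ℤ → ZMod 2)
    (h : ∀ i j, i < j → U i → U j → (∀ k, i < k → k < j → ¬ U k) →
      ∑ t ∈ Finset.Ico i j, c t = ((j - i : ℤ) : ZMod 2)) (i j : ℤ) (hij : i ≤ j)
    (hi : U i) (hj : U j) : ∑ t ∈ Finset.Ico i j, c t = ((j - i : ℤ) : ZMod 2) := by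
  induction hd : (j - i).toNat using Nat.strong_induction_on generalizing j with
  | _ d ih =>
    rcases eq_or_lt_of_le hij with rfl | hlt
    · simp
    · obtain ⟨k, h1, h2, h3, h4⟩ := exists_last U (show i ≤ j - 1 by omega) hi
      have := ih (k - i).toNat (by omega) k h1 h3 rfl
      rw [← sum_Ico_add_sum_Ico c h1 (show k ≤ j by omega), this,
        h k j (by omega) h3 hj fun m h5 h6 => h4 m h5 (by omega)]
      push_cast
      ring

theorem sum_Ico_telescope (β : ℤ → ZMod 2) {i j : ℤ} (hij : i ≤ j) :
    ∑ t ∈ Finset.Ico i j, (β t + β (t + 1)) = β i + β j := by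
  induction j, hij using Int.leInduction with
  | base => simp [CharTwo.add_self_eq_zero]
  | succ j hij ih =>
    rw [← sum_Ico_add_sum_Ico _ hij (show j ≤ j + 1 by omega), ih, sum_Ico_self_succ]
    linear_combination CharTwo.add_self_eq_zero (β j)

open Classical in
/-- The indicator, modulo two, of the pairs `{t, t + 1}` contained in `U`. -/
noncomputable def edgeInd (U : ℤ → Prop) (t : ℤ) : ZMod 2 :=
  if U t ∧ U (t + 1) then 1 else 0

theorem edgeInd_eq_one {U : ℤ → Prop} {t : ℤ} (h : U t) (h' : U (t + 1)) : edgeInd U t = 1 :=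
  if_pos ⟨h, h'⟩

theorem edgeInd_eq_zero {U : ℤ → Prop} {t : ℤ} (h : ¬ (U t ∧ U (t + 1))) : edgeInd U t = 0 :=
  if_neg h

theorem edgeInd_periodic {n : ℕ} {U : ℤ → Prop} (hU : ∀ i, U (i + n) ↔ U i) (t : ℤ) :
    edgeInd U (t + n) = edgeInd U t := by
  unfold edgeInd
  rw [add_right_comm, hU, hU]

theorem intCast_eq_one_of_odd {m : ℤ} (h : Odd m) : (m : ZMod 2) = 1 := by
  obtain ⟨r, rfl⟩ := h
  push_cast
  rw [show (2 : ZMod 2) = 0 from rfl, zero_mul, zero_add]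

theorem intCast_eq_zero_of_even {m : ℤ} (h : Even m) : (m : ZMod 2) = 0 := by
  obtain ⟨r, rfl⟩ := h
  push_cast
  exact CharTwo.add_self_eq_zero _

/-- A nonempty subset of an odd cycle all of whose gaps are even contains an odd number of
edges. -/
theorem sum_edgeInd_eq_one {n : ℕ} (hn : Odd n) {U : ℤ → Prop} (hper : ∀ i, U (i + n) ↔ U i)
    (heven : ∀ i j, i + 2 ≤ j → U i → U j → (∀ k, i < k → k < j → ¬ U k) → Even (j - i))
    (hne : ∃ i, U i) (m : ℤ) : ∑ t ∈ Finset.Ico m (m + n), edgeInd U t = 1 := by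
  obtain ⟨i, hi⟩ := hne
  rw [sum_Ico_period_eq (edgeInd_periodic hper) m i,
    sum_Ico_eq_of_consecutive U _ _ i (i + n) (by omega) hi ((hper i).2 hi)]
  · rw [add_sub_cancel_left]
    exact intCast_eq_one_of_odd (by exact_mod_cast hn)
  · intro s t hst hs ht hgap
    rcases eq_or_lt_of_le (show s + 1 ≤ t by omega) with rfl | h
    · rw [sum_Ico_self_succ, edgeInd_eq_one hs ht, add_sub_cancel_left, Int.cast_one]
    · rw [intCast_eq_zero_of_even (heven s t (by omega) hs ht hgap)]
      refine Finset.sum_eq_zero fun k hk => edgeInd_eq_zero ?_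
      rw [Finset.mem_Ico] at hk
      rintro ⟨h1, h2⟩
      rcases eq_or_lt_of_le hk.1 with rfl | h3
      · exact hgap _ (by omega) (by omega) h2
      · exact hgap _ h3 hk.2 h1

end CyclicSums

section Links

/-- On the interval `[i, j]`, `a` holds exactly at `i` and `b` exactly at `j`. -/
structure Link (a b : ℤ → Prop) (i j : ℤ) : Prop where
  le : i ≤ j
  left : a i
  right : b j
  not_left : ∀ k, i < k → k ≤ j → ¬ a k
  not_right : ∀ k, i ≤ k → k < j → ¬ b k

/-- A link in one of the two directions. -/
def Mixed (a b : ℤ → Prop) (i j : ℤ) : Prop :=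
  Link a b i j ∨ Link b a i j

/-- The combinatorial properties of the neighbours `a` and `b`, on a shortest odd hole of
length `n`, of two nonadjacent major vertices. -/
structure NbrPair (n : ℕ) (a b : ℤ → Prop) : Prop where
  odd : Odd n
  periodic_a : ∀ i, a (i + n) ↔ a i
  periodic_b : ∀ i, b (i + n) ↔ b i
  even_a : ∀ i j, i + 2 ≤ j → a i → a j → (∀ k, i < k → k < j → ¬ a k) → Even (j - i)
  even_b : ∀ i j, i + 2 ≤ j → b i → b j → (∀ k, i < k → k < j → ¬ b k) → Even (j - i)
  spread_a : ∀ i : ℤ, ∃ j, i + 2 ≤ j ∧ j ≤ i + n - 2 ∧ a j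
  spread_b : ∀ i : ℤ, ∃ j, i + 2 ≤ j ∧ j ≤ i + n - 2 ∧ b j
  three_a : ∀ i j, a i → a (i + 1) → a j → i + 3 ≤ j → j + 2 ≤ i + n →
    (∀ k, i + 2 ≤ k → k < i + n → k ≠ j → ¬ a k) → False
  three_b : ∀ i j, b i → b (i + 1) → b j → i + 3 ≤ j → j + 2 ≤ i + n →
    (∀ k, i + 2 ≤ k → k < i + n → k ≠ j → ¬ b k) → False
  four_a : ∀ i, a i → a (i + 3) → (∀ k, i + 4 ≤ k → k < i + n → ¬ a k) → False
  four_b : ∀ i, b i → b (i + 3) → (∀ k, i + 4 ≤ k → k < i + n → ¬ b k) → False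
  hole : ∀ i j k l, Mixed a b i j → Mixed a b k l → j + 2 ≤ k → l + 2 ≤ i + n →
    Odd (j - i + (l - k)) → n ≤ j - i + (l - k) + 4
  pyramid_left : ∀ i j k l, Mixed a b i j → Mixed a b k l → i < j → a (i - 1) → b (i - 1) →
    j + 2 ≤ k → l + 3 ≤ i + n → False
  pyramid_right : ∀ i j k l, Mixed a b i j → Mixed a b k l → i < j → a (j + 1) → b (j + 1) →
    j + 3 ≤ k → l + 2 ≤ i + n → False

variable {n : ℕ} {a b : ℤ → Prop} {i j k l : ℤ}

theorem Mixed.swap (h : Mixed a b i j) : Mixed b a i j := Or.symm h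

theorem Mixed.le (h : Mixed a b i j) : i ≤ j := h.elim Link.le Link.le

theorem Link.neg (h : Link a b i j) : Link (fun t => b (-t)) (fun t => a (-t)) (-j) (-i) where
  le := neg_le_neg h.le
  left := by simpa using h.right
  right := by simpa using h.left
  not_left k h1 h2 := h.not_right _ (by omega) (by omega)
  not_right k h1 h2 := h.not_left _ (by omega) (by omega)

theorem Mixed.neg (h : Mixed a b i j) : Mixed (fun t => a (-t)) (fun t => b (-t)) (-j) (-i) :=
  h.elim (fun h => Or.inr h.neg) (fun h => Or.inl h.neg)

theorem Mixed.of_neg (h : Mixed (fun t => a (-t)) (fun t => b (-t)) i j) :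
    Mixed a b (-j) (-i) := by
  simpa using h.neg

theorem NbrPair.swap (H : NbrPair n a b) : NbrPair n b a where
  odd := H.odd
  periodic_a := H.periodic_b
  periodic_b := H.periodic_a
  even_a := H.even_b
  even_b := H.even_a
  spread_a := H.spread_b
  spread_b := H.spread_a
  three_a := H.three_b
  three_b := H.three_a
  four_a := H.four_b
  four_b := H.four_a
  hole i j k l h1 h2 := H.hole i j k l h1.swap h2.swap
  pyramid_left i j k l h1 h2 h3 h4 h5 := H.pyramid_left i j k l h1.swap h2.swap h3 h5 h4
  pyramid_right i j k l h1 h2 h3 h4 h5 := H.pyramid_right i j k l h1.swap h2.swap h3 h5 h4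

theorem exists_link (hij : i ≤ j) (hi : a i) (hj : b j) :
    ∃ k l, i ≤ k ∧ l ≤ j ∧ Link a b k l := by
  obtain ⟨k, h1, h2, h3, h4⟩ := exists_last a hij hi
  obtain ⟨l, h5, h6, h7, h8⟩ := exists_first b h2 hj
  exact ⟨k, l, h1, h6, h5, h3, h7, fun m h h' => h4 m h (by omega), h8⟩

theorem exists_mixed (hk : i ≤ k) (hk' : k ≤ j) (hl : i ≤ l) (hl' : l ≤ j) (hak : a k)
    (hbl : b l) : ∃ s t, i ≤ s ∧ t ≤ j ∧ Mixed a b s t := by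
  rcases le_total k l with h | h
  · obtain ⟨s, t, h1, h2, h3⟩ := exists_link h hak hbl
    exact ⟨s, t, by omega, by omega, Or.inl h3⟩
  · obtain ⟨s, t, h1, h2, h3⟩ := exists_link h hbl hak
    exact ⟨s, t, by omega, by omega, Or.inr h3⟩

theorem Link.shift {c : ℤ} (ha : ∀ i, a (i + c) ↔ a i) (hb : ∀ i, b (i + c) ↔ b i)
    (h : Link a b i j) : Link a b (i + c) (j + c) where
  le := by have := h.le; omega
  left := (ha i).2 h.left
  right := (hb j).2 h.right
  not_left k h1 h2 := by
    rw [← sub_add_cancel k c, ha]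
    exact h.not_left _ (by omega) (by omega)
  not_right k h1 h2 := by
    rw [← sub_add_cancel k c, hb]
    exact h.not_right _ (by omega) (by omega)

namespace NbrPair

theorem mixed_shift (H : NbrPair n a b) (h : Mixed a b i j) : Mixed a b (i + n) (j + n) :=
  h.imp (Link.shift H.periodic_a H.periodic_b) (Link.shift H.periodic_b H.periodic_a)

theorem neg (H : NbrPair n a b) : NbrPair n (fun t => a (-t)) (fun t => b (-t)) where
  odd := H.odd
  periodic_a i := by rw [← H.periodic_a, neg_add, neg_add_cancel_right]
  periodic_b i := by rw [← H.periodic_b, neg_add, neg_add_cancel_right]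
  even_a i j h hi hj hk := by
    have := H.even_a (-j) (-i) (by omega) hj hi fun k h1 h2 => by
      simpa using hk (-k) (by omega) (by omega)
    simpa [add_comm, sub_eq_add_neg] using this
  even_b i j h hi hj hk := by
    have := H.even_b (-j) (-i) (by omega) hj hi fun k h1 h2 => by
      simpa using hk (-k) (by omega) (by omega)
    simpa [add_comm, sub_eq_add_neg] using this
  spread_a i := by
    obtain ⟨j, h1, h2, h3⟩ := H.spread_a (-i - n)
    exact ⟨-j, by omega, by omega, by simpa using h3⟩
  spread_b i := by
    obtain ⟨j, h1, h2, h3⟩ := H.spread_b (-i - n)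
    exact ⟨-j, by omega, by omega, by simpa using h3⟩
  three_a i j hi hi' hj h1 h2 h3 := by
    refine H.three_a (-i - 1) (-j + n) (by convert hi' using 1; ring) (by simpa using hi)
      ((H.periodic_a _).2 hj) (by omega) (by omega) fun k h4 h5 h6 h7 => ?_
    refine h3 (-k + n) (by omega) (by omega) (by omega) ?_
    rw [← H.periodic_a]
    convert h7 using 1
    ring
  three_b i j hi hi' hj h1 h2 h3 := by
    refine H.three_b (-i - 1) (-j + n) (by convert hi' using 1; ring) (by simpa using hi)
      ((H.periodic_b _).2 hj) (by omega) (by omega) fun k h4 h5 h6 h7 => ?_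
    refine h3 (-k + n) (by omega) (by omega) (by omega) ?_
    rw [← H.periodic_b]
    convert h7 using 1
    ring
  four_a i hi hi' h := by
    refine H.four_a (-i - 3) (by convert hi' using 1; ring) (by simpa using hi) fun k h1 h2 h3 => ?_
    refine h (-k + n) (by omega) (by omega) ?_
    rw [← H.periodic_a]
    convert h3 using 1
    ring
  four_b i hi hi' h := by
    refine H.four_b (-i - 3) (by convert hi' using 1; ring) (by simpa using hi) fun k h1 h2 h3 => ?_
    refine h (-k + n) (by omega) (by omega) ?_
    rw [← H.periodic_b]
    convert h3 using 1
    ring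
  hole i j k l h1 h2 h3 h4 h5 := by
    have := H.hole (-l) (-k) (-j) (-i) h2.of_neg h1.of_neg (by omega) (by omega)
      (by convert h5 using 1; ring)
    omega
  pyramid_left i j k l h1 h2 h3 h4 h5 h6 h7 :=
    H.pyramid_right (-j) (-i) (-l + n) (-k + n) h1.of_neg (H.mixed_shift h2.of_neg) (by omega)
      (by convert h4 using 1; ring) (by convert h5 using 1; ring) (by omega) (by omega)
  pyramid_right i j k l h1 h2 h3 h4 h5 h6 h7 :=
    H.pyramid_left (-j) (-i) (-l + n) (-k + n) h1.of_neg (H.mixed_shift h2.of_neg) (by omega)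
      (by convert h4 using 1; ring) (by convert h5 using 1; ring) (by omega) (by omega)

theorem false_of_odd_link_of_even_mixed (H : NbrPair n a b) (hP : Link a b i j)
    (hQ : Mixed a b k l) (hjk : j + 2 ≤ k) (hli : l + 2 ≤ i + n) (hodd : Odd (j - i))
    (heven : Even (l - k)) : False := by
  have hn := H.hole i j k l (Or.inl hP) hQ hjk hli (hodd.add_even heven)
  have hkl := hQ.le
  obtain ⟨r, hr⟩ := hodd
  obtain ⟨s, hs⟩ := heven
  obtain ⟨m, hm⟩ := H.odd
  obtain rfl : k = j + 2 := by omega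
  obtain rfl : l = i + n - 2 := by omega
  have hij := hP.le
  have hin : a (i + n) := (H.periodic_a i).2 hP.left
  rcases hQ with hQ | hQ
  · rcases eq_or_lt_of_le hkl with hkl | hkl
    · by_cases ha : a (j + 1)
      · refine H.four_a (j + 1) ha (by convert hin using 1; omega) fun t h1 h2 h3 => ?_
        rw [← sub_add_cancel t n, H.periodic_a] at h3
        exact hP.not_left _ (by omega) (by omega) h3
      · obtain ⟨t, h1, h2, h3⟩ := H.spread_a (i - 1)
        rcases eq_or_lt_of_le (show t ≤ j + 1 by omega) with rfl | h
        · exact ha h3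
        · exact hP.not_left t (by omega) (by omega) h3
    · by_cases hlast : a (i + n - 1)
      · obtain ⟨u, hu⟩ := H.even_a (j + 2) (i + n - 1) (by omega) hQ.left hlast
          fun t h1 h2 => hQ.not_left t h1 (by omega)
        omega
      · by_cases ha : a (j + 1)
        · refine H.three_a (j + 1) (i + n) ha (by convert hQ.left using 1; ring) hin (by omega)
            (by omega) fun t h1 h2 h3 h4 => ?_
          rcases lt_trichotomy t (i + n - 1) with h | rfl | h
          · exact hQ.not_left t (by omega) (by omega) h4
          · exact hlast h4
          · rw [← sub_add_cancel t n, H.periodic_a] at h4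
            exact hP.not_left _ (by omega) (by omega) h4
        · obtain ⟨u, hu⟩ := H.even_a i (j + 2) (by omega) hP.left hQ.left fun t h1 h2 h3 => by
            rcases eq_or_lt_of_le (show t ≤ j + 1 by omega) with rfl | h
            · exact ha h3
            · exact hP.not_left t (by omega) (by omega) h3
          omega
  · by_cases ha : a (j + 1)
    · rcases eq_or_lt_of_le hkl with hkl | hkl
      · refine H.four_a (j + 1) ha (by convert hin using 1; omega) fun t h1 h2 h3 => ?_
        rw [← sub_add_cancel t n, H.periodic_a] at h3
        exact hP.not_left _ (by omega) (by omega) h3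
      · obtain ⟨u, hu⟩ := H.even_a (j + 1) (i + n - 2) (by omega) ha hQ.right
          fun t h1 h2 => hQ.not_right t (by omega) (by omega)
        omega
    · obtain ⟨t, h1, h2, h3⟩ := H.spread_a (i - 1)
      rcases lt_trichotomy t (j + 1) with h | rfl | h
      · exact hP.not_left t (by omega) (by omega) h3
      · exact ha h3
      · exact hQ.not_right t (by omega) (by omega) h3

theorem false_of_odd_of_even (H : NbrPair n a b) (hP : Mixed a b i j)
    (hQ : Mixed a b k l) (hjk : j + 2 ≤ k) (hli : l + 2 ≤ i + n) (hodd : Odd (j - i))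
    (heven : Even (l - k)) : False :=
  hP.elim
    (fun h => H.false_of_odd_link_of_even_mixed h hQ hjk hli hodd heven)
    (fun h => H.swap.false_of_odd_link_of_even_mixed h hQ.swap hjk hli hodd heven)

theorem exists_left_far (H : NbrPair n a b) (hP : Link a b i j) (hodd : Odd (j - i)) :
    ∃ k, j + 2 ≤ k ∧ k + 2 ≤ i + n ∧ a k := by
  by_contra! hfar
  obtain ⟨r, hr⟩ := hodd
  obtain ⟨m, hm⟩ := H.odd
  have hij := hP.le
  have hin : a (i + n) := (H.periodic_a i).2 hP.left
  obtain ⟨t, h1, h2, h3⟩ := H.spread_a i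
  have ht : t = j + 1 := by
    by_contra hne
    rcases Int.lt_or_gt_of_ne hne with h | h
    · exact hP.not_left t (by omega) (by omega) h3
    · exact hfar t (by omega) (by omega) h3
  subst ht
  by_cases hlast : a (i + n - 1)
  · refine H.three_a (i + n - 1) (j + 1 + n) hlast (by simpa using hin)
      ((H.periodic_a _).2 h3) (by omega) (by omega) fun s h4 h5 h6 h7 => ?_
    rw [← sub_add_cancel s n, H.periodic_a] at h7
    rcases Int.lt_or_gt_of_ne h6 with h | h
    · exact hP.not_left _ (by omega) (by omega) h7
    · exact hfar _ (by omega) (by omega) h7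
  · obtain ⟨u, hu⟩ := H.even_a (j + 1) (i + n) (by omega) h3 hin fun s h4 h5 h6 => by
      rcases eq_or_lt_of_le (show s ≤ i + n - 1 by omega) with rfl | h
      · exact hlast h6
      · exact hfar s (by omega) (by omega) h6
    omega

theorem exists_right_far (H : NbrPair n a b) (hP : Link a b i j) (hodd : Odd (j - i)) :
    ∃ k, j + 2 ≤ k ∧ k + 2 ≤ i + n ∧ b k := by
  obtain ⟨k, h1, h2, h3⟩ := H.neg.swap.exists_left_far hP.neg (by convert hodd using 1; ring)
  exact ⟨-k + n, by omega, by omega, (H.periodic_b _).2 h3⟩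

theorem not_both_before (H : NbrPair n a b) (hP : Link a b i j) (hodd : Odd (j - i))
    (ha : a (i - 1)) (hb : b (i - 1)) : False := by
  have hij := hP.le
  obtain ⟨k, hk, hk', hak⟩ := H.exists_left_far hP hodd
  obtain ⟨l, hl, hl', hbl⟩ := H.exists_right_far hP hodd
  obtain ⟨m, hm⟩ := H.odd
  have hP' := hodd
  obtain ⟨r, hr⟩ := hodd
  have hin : a (i + n) := (H.periodic_a i).2 hP.left
  have ha' : a (i + n - 1) := by
    rw [← H.periodic_a] at ha; convert ha using 1; ring
  have hb' : b (i + n - 1) := by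
    rw [← H.periodic_b] at hb; convert hb using 1; ring
  by_cases hA : ∃ k, j + 2 ≤ k ∧ k + 3 ≤ i + n ∧ a k
  · by_cases hB : ∃ k, j + 2 ≤ k ∧ k + 3 ≤ i + n ∧ b k
    · obtain ⟨k, hk, hk', hak⟩ := hA
      obtain ⟨l, hl, hl', hbl⟩ := hB
      obtain ⟨s, t, h1, h2, h3⟩ := exists_mixed (i := j + 2) (j := i + n - 3) hk (by omega) hl
        (by omega) hak hbl
      exact H.pyramid_left i j s t (Or.inl hP) h3 (by omega) ha hb h1 (by omega)
    · push Not at hB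
      obtain rfl : l = i + n - 2 := by
        by_contra h
        exact hB l hl (by omega) hbl
      by_cases hb1 : b (j + 1)
      · rcases eq_or_lt_of_le hl with h | h
        · refine H.four_b j hP.right (by convert hb' using 1; omega) fun s h1 h2 h3 => ?_
          rw [← sub_add_cancel s n, H.periodic_b] at h3
          exact hP.not_right _ (by omega) (by omega) h3
        · obtain ⟨u, hu⟩ := H.even_b (j + 1) (i + n - 2) (by omega) hb1 hbl
            fun s h1 h2 => hB s (by omega) (by omega)
          omega
      · refine H.three_b (i + n - 2) (j + n) hbl (by convert hb' using 1; ring)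
          ((H.periodic_b _).2 hP.right) (by omega) (by omega) fun s h1 h2 h3 h4 => ?_
        rw [← sub_add_cancel s n, H.periodic_b] at h4
        rcases lt_trichotomy (s - n) (j + 1) with h | h | h
        · exact hP.not_right _ (by omega) (by omega) h4
        · exact hb1 (h ▸ h4)
        · exact hB _ (by omega) (by omega) h4
  · push Not at hA
    obtain rfl : k = i + n - 2 := by
      by_contra h
      exact hA k hk (by omega) hak
    obtain ⟨t, h1, h2, h3⟩ := H.spread_a (i - 1)
    have ht : t = j + 1 := by
      by_contra hne
      rcases Int.lt_or_gt_of_ne hne with h | h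
      · exact hP.not_left t (by omega) (by omega) h3
      · exact hA t (by omega) (by omega) h3
    subst ht
    rcases eq_or_lt_of_le hk with h | h
    · refine H.four_a (j + 1) h3 (by convert hin using 1; omega) fun s h1 h2 h3 => ?_
      rw [← sub_add_cancel s n, H.periodic_a] at h3
      exact hP.not_left _ (by omega) (by omega) h3
    · obtain ⟨u, hu⟩ := H.even_a (j + 1) (i + n - 2) (by omega) h3 hak
        fun s h1 h2 => hA s (by omega) (by omega)
      omega

/-- Every integer is congruent to one in the window of length `n` starting at `i`. -/
theorem exists_window (H : NbrPair n a b) (i k : ℤ) :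
    ∃ t : ℤ, i ≤ k + n * t ∧ k + n * t < i + n := by
  have hn : (0 : ℤ) < n := by
    obtain ⟨m, hm⟩ := H.odd
    omega
  refine ⟨-((k - i) / n), ?_, ?_⟩
  · have := Int.emod_nonneg (k - i) hn.ne'
    have := Int.emod_add_mul_ediv (k - i) n
    linarith
  · have := Int.emod_lt_of_pos (k - i) hn
    have := Int.emod_add_mul_ediv (k - i) n
    linarith

theorem left_add_mul (H : NbrPair n a b) (k t : ℤ) : a (k + n * t) ↔ a k := by
  induction t with
  | zero => simp
  | succ t ih => rw [mul_add, mul_one, ← add_assoc, H.periodic_a, ih]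
  | pred t ih =>
    rw [← H.periodic_a, mul_sub, mul_one, add_assoc, sub_add_cancel, ih]

theorem mixed_add_mul (H : NbrPair n a b) (t : ℤ) (h : Mixed a b k l) :
    Mixed a b (k + n * t) (l + n * t) :=
  h.imp (Link.shift (H.left_add_mul · t) (H.swap.left_add_mul · t))
    (Link.shift (H.swap.left_add_mul · t) (H.left_add_mul · t))

theorem not_both_of_link (H : NbrPair n a b) (hP : Link a b i j) (hodd : Odd (j - i)) (k : ℤ) :
    ¬ (a k ∧ b k) := by
  obtain ⟨t, h1, h2⟩ := H.exists_window i k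
  rw [← H.left_add_mul k t, ← H.swap.left_add_mul k t]
  generalize k + n * t = k at h1 h2
  rintro ⟨ha, hb⟩
  have hij : i < j := lt_of_le_of_ne hP.le fun h => by simp [h] at hodd
  by_cases hk : k ≤ j
  · rcases eq_or_lt_of_le hk with h | h
    · exact hP.not_left k (by omega) hk ha
    · exact hP.not_right k h1 h hb
  · by_cases hk1 : k = j + 1
    · subst hk1
      refine H.neg.swap.not_both_before hP.neg (by convert hodd using 1; ring) ?_ ?_
      · convert hb using 1; ring
      · convert ha using 1; ring
    · by_cases hk2 : k = i + n - 1
      · subst hk2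
        refine H.not_both_before hP hodd ?_ ?_
        · rw [← H.periodic_a]; convert ha using 1; ring
        · rw [← H.periodic_b]; convert hb using 1; ring
      · refine H.false_of_odd_of_even (k := k) (l := k) (Or.inl hP) (Or.inl ⟨le_rfl, ha, hb, ?_, ?_⟩)
          (by omega) (by omega) hodd (by simp)
        · intro m h3 h4; omega
        · intro m h3 h4; omega

theorem not_both (H : NbrPair n a b) (hP : Mixed a b i j) (hodd : Odd (j - i)) (k : ℤ) :
    ¬ (a k ∧ b k) :=
  hP.elim (fun h => H.not_both_of_link h hodd k)
    (fun h h' => H.swap.not_both_of_link h hodd k h'.symm)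

theorem exists_even_mixed (H : NbrPair n a b) (hP : Link a b i j) (hodd : Odd (j - i)) :
    ∃ k l, Mixed a b k l ∧ Even (l - k) := by
  classical
  by_contra! hcon
  have hdisj := H.not_both (Or.inl hP) hodd
  have hA := sum_edgeInd_eq_one H.odd H.periodic_a H.even_a ⟨i, hP.left⟩ i
  have hB := sum_edgeInd_eq_one H.odd H.periodic_b H.even_b ⟨j, hP.right⟩ i
  set β : ℤ → ZMod 2 := fun t => if b t then 1 else 0 with hβ
  have hβt (t : ℤ) (ht : b t) : β t = 1 := if_pos ht
  have hβf (t : ℤ) (ht : ¬ b t) : β t = 0 := if_neg ht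
  have htot := sum_Ico_eq_of_consecutive (fun t => a t ∨ b t)
    (fun t => edgeInd a t + edgeInd b t + (β t + β (t + 1))) (by
      intro s t hst hs ht hgap
      rw [Finset.sum_add_distrib, sum_Ico_telescope β hst.le]
      have hzero (h : ¬ (a s ∧ a t) ∧ ¬ (b s ∧ b t) ∨ s + 2 ≤ t) :
          ∑ k ∈ Finset.Ico s t, (edgeInd a k + edgeInd b k) = 0 := by
        refine Finset.sum_eq_zero fun k hk => ?_
        rw [Finset.mem_Ico] at hk
        have key (h' : (a k ∨ b k) ∧ (a (k + 1) ∨ b (k + 1))) : k = s ∧ k + 1 = t := by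
          by_contra hne
          rcases eq_or_lt_of_le hk.1 with h3 | h3
          · exact hgap (k + 1) (by omega) (by omega) h'.2
          · exact hgap k h3 hk.2 h'.1
        rw [edgeInd_eq_zero, edgeInd_eq_zero, add_zero]
        · rintro ⟨h1, h2⟩
          obtain ⟨rfl, rfl⟩ := key ⟨Or.inr h1, Or.inr h2⟩
          exact h.elim (fun h => h.2 ⟨h1, h2⟩) (by omega)
        · rintro ⟨h1, h2⟩
          obtain ⟨rfl, rfl⟩ := key ⟨Or.inl h1, Or.inl h2⟩
          exact h.elim (fun h => h.1 ⟨h1, h2⟩) (by omega)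
      have hmixed (h : Mixed a b s t) : ((t - s : ℤ) : ZMod 2) = 1 :=
        intCast_eq_one_of_odd (Int.not_even_iff_odd.1 (hcon s t h))
      rcases hs with hs | hs <;> rcases ht with ht | ht
      · rw [hβf s fun h => hdisj s ⟨hs, h⟩, hβf t fun h => hdisj t ⟨ht, h⟩]
        rcases eq_or_lt_of_le (show s + 1 ≤ t by omega) with rfl | h
        · rw [sum_Ico_self_succ, edgeInd_eq_one hs ht,
            edgeInd_eq_zero fun h => hdisj s ⟨hs, h.1⟩]
          simp
        · rw [hzero (Or.inr (by omega)), intCast_eq_zero_of_even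
            (H.even_a s t (by omega) hs ht fun k h1 h2 h3 => hgap k h1 h2 (Or.inl h3))]
          simp
      · rw [hβf s fun h => hdisj s ⟨hs, h⟩, hβt t ht, hmixed, hzero]
        · simp
        · exact Or.inl ⟨fun h => hdisj t ⟨h.2, ht⟩, fun h => hdisj s ⟨hs, h.1⟩⟩
        · refine Or.inl ⟨hst.le, hs, ht, fun k h1 h2 h3 => ?_, fun k h1 h2 h3 => ?_⟩
          · rcases eq_or_lt_of_le h2 with rfl | h2
            · exact hdisj k ⟨h3, ht⟩
            · exact hgap k h1 h2 (Or.inl h3)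
          · rcases eq_or_lt_of_le h1 with rfl | h1
            · exact hdisj _ ⟨hs, h3⟩
            · exact hgap k h1 h2 (Or.inr h3)
      · rw [hβf t fun h => hdisj t ⟨ht, h⟩, hβt s hs, hmixed, hzero]
        · simp
        · exact Or.inl ⟨fun h => hdisj s ⟨h.1, hs⟩, fun h => hdisj t ⟨ht, h.2⟩⟩
        · refine Or.inr ⟨hst.le, hs, ht, fun k h1 h2 h3 => ?_, fun k h1 h2 h3 => ?_⟩
          · rcases eq_or_lt_of_le h2 with rfl | h2
            · exact hdisj k ⟨ht, h3⟩
            · exact hgap k h1 h2 (Or.inr h3)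
          · rcases eq_or_lt_of_le h1 with rfl | h1
            · exact hdisj _ ⟨h3, hs⟩
            · exact hgap k h1 h2 (Or.inl h3)
      · rw [hβt s hs, hβt t ht, CharTwo.add_self_eq_zero, add_zero]
        rcases eq_or_lt_of_le (show s + 1 ≤ t by omega) with rfl | h
        · rw [sum_Ico_self_succ, edgeInd_eq_one hs ht,
            edgeInd_eq_zero fun h => hdisj s ⟨h.1, hs⟩]
          simp
        · rw [hzero (Or.inr (by omega)), intCast_eq_zero_of_even
            (H.even_b s t (by omega) hs ht fun k h1 h2 h3 => hgap k h1 h2 (Or.inr h3))])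
    i (i + n) (by omega) (Or.inl hP.left) (Or.inl ((H.periodic_a i).2 hP.left))
  have hi : ¬ b i := fun h => hdisj i ⟨hP.left, h⟩
  rw [Finset.sum_add_distrib, Finset.sum_add_distrib, hA, hB, sum_Ico_telescope β (by omega),
    hβf i hi, hβf (i + n) (by rwa [H.periodic_b]), add_sub_cancel_left,
    intCast_eq_one_of_odd (by exact_mod_cast H.odd)] at htot
  exact absurd htot (by decide)

theorem false_of_consecutive (H : NbrPair n a b) (hP : Link b a i j) (hodd : Odd (j - i))
    (hE : Link a b (j + 1) l) (heven : Even (l - (j + 1))) : False := by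
  have hdisj := H.not_both (Or.inr hP) hodd
  have hPij := hP.le
  have hEjl := hE.le
  have hPP := hP.shift H.periodic_b H.periodic_a
  have hEE := H.mixed_shift (Or.inl hE)
  have hPa (t : ℤ) (h1 : i + n ≤ t) (h2 : t < j + n) : ¬ a t := hPP.not_right t h1 h2
  have hjl : j + 1 ≠ l := by
    rintro rfl
    exact hdisj _ ⟨hE.left, hE.right⟩
  obtain ⟨r, hr⟩ := id hodd
  obtain ⟨s, hs⟩ := id heven
  obtain ⟨m, hm⟩ := H.odd
  obtain ⟨u, hu1, hu2, hu⟩ := H.spread_a j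
  have hlu : l + 1 ≤ u := by
    by_contra h
    exact hE.not_left u (by omega) (by omega) hu
  obtain ⟨w, hw1, hw2, hw, hwfirst⟩ := exists_first a hlu hu
  have hwi : w < i + n := by
    by_contra h
    exact hPa w (by omega) (by omega) hw
  have hgap (k : ℤ) (h1 : j + 1 < k) (h2 : k < w) : ¬ a k := by
    rcases le_or_gt k l with h | h
    · exact hE.not_left k h1 h
    · exact hwfirst k (by omega) h2
  obtain ⟨e1, he1⟩ := H.even_a (j + 1) w (by omega) hE.left hw hgap
  obtain ⟨v, hv1, hv2, hv, hvlast⟩ := exists_last b (show l ≤ w by omega) hE.right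
  have hvw : v ≠ w := by
    rintro rfl
    exact hdisj _ ⟨hw, hv⟩
  have hQ : Mixed a b v w := Or.inr ⟨hv2, hv, hw, hvlast, fun k h1 h2 => hgap k (by omega) h2⟩
  rcases Int.even_or_odd (w - v) with hpar | hpar
  · by_cases hw' : w + 2 ≤ i + n
    · exact H.false_of_odd_of_even (Or.inr hP) hQ (by omega) hw' hodd hpar
    · refine H.three_a j w hP.right hE.left hw (by omega) (by omega) fun k h1 h2 h3 => ?_
      rcases Int.lt_or_gt_of_ne h3 with h | h
      · exact hgap k (by omega) h
      · exact hPa k (by omega) h2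
  · by_cases hvl : l + 2 ≤ v
    · exact H.false_of_odd_of_even hQ hEE (by omega) (by omega) hpar (by simpa using heven)
    obtain ⟨e2, he2⟩ := hpar
    obtain ⟨z, hz1, hz2, hz, hzfirst⟩ := exists_first b (show w + 1 ≤ i + n by omega) hPP.left
    obtain ⟨e3, he3⟩ := H.even_b v z (by omega) hv hz fun k h1 h2 => by
      rcases le_or_gt k w with h | h
      · exact hvlast k h1 h
      · exact hzfirst k (by omega) h2
    obtain ⟨w', hw1', hw2', hw', hwlast'⟩ := exists_last a (show w ≤ z by omega) hw
    have hwz' : w' ≠ z := by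
      rintro rfl
      exact hdisj _ ⟨hw', hz⟩
    have hG : Mixed a b w' z := Or.inl ⟨hw2', hw', hz, hwlast', fun k h1 h2 => by
      rcases eq_or_lt_of_le (show w ≤ k by omega) with rfl | h
      · exact hvlast _ (by omega) le_rfl
      · exact hzfirst k (by omega) h2⟩
    rcases Int.even_or_odd (z - w') with hpar | hpar
    · by_cases hzi : z + 2 ≤ i + n
      · exact H.false_of_odd_of_even (Or.inr hP) hG (by omega) hzi hodd hpar
      · obtain ⟨e4, he4⟩ := H.even_a w' (j + n) (by omega) hw' hPP.right fun k h1 h2 => by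
          rcases le_or_gt k z with h | h
          · exact hwlast' k h1 h
          · exact hPa k (by omega) h2
        obtain ⟨e5, he5⟩ := hpar
        omega
    · exact H.false_of_odd_of_even hG hEE (by omega) (by omega) hpar (by simpa using heven)

theorem false_of_touching_link (H : NbrPair n a b) (hP : Link b a i j) (hodd : Odd (j - i))
    (hE : Mixed a b k l) (heven : Even (l - k)) (hk : k = j ∨ k = j + 1) : False := by
  have hdisj := H.not_both (Or.inr hP) hodd
  have hPij := hP.le
  have hEkl := hE.le
  have hkl : k ≠ l := by
    rintro rfl
    exact hE.elim (fun h => hdisj _ ⟨h.left, h.right⟩) (fun h => hdisj _ ⟨h.right, h.left⟩)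
  obtain ⟨r, hr⟩ := id hodd
  obtain ⟨s, hs⟩ := id heven
  rcases hk with rfl | rfl <;> rcases hE with hE | hE
  · obtain ⟨e, he⟩ := H.even_b i l (by omega) hP.left hE.right fun t h1 h2 => by
      rcases le_or_gt t k with h | h
      · exact hP.not_left t h1 h
      · exact hE.not_right t h.le h2
    omega
  · exact hdisj _ ⟨hP.right, hE.left⟩
  · exact H.false_of_consecutive hP hodd hE heven
  · obtain ⟨e, he⟩ := H.even_a j l (by omega) hP.right hE.right fun t h1 h2 =>
      hE.not_right t (by omega) h2
    omega

theorem false_of_touching (H : NbrPair n a b) (hP : Mixed a b i j) (hodd : Odd (j - i))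
    (hE : Mixed a b k l) (heven : Even (l - k)) (hk : k = j ∨ k = j + 1) : False :=
  hP.elim (fun h => H.swap.false_of_touching_link h hodd hE.swap heven hk)
    (fun h => H.false_of_touching_link h hodd hE heven hk)

theorem not_mem_interior {t : ℤ} (hP : Mixed a b i j) (h1 : i < t) (h2 : t < j) :
    ¬ a t ∧ ¬ b t :=
  hP.elim (fun h => ⟨h.not_left t h1 h2.le, h.not_right t h1.le h2⟩)
    (fun h => ⟨h.not_right t h1.le h2, h.not_left t h1 h2.le⟩)

theorem mem_ends (hP : Mixed a b i j) : (a i ∨ b i) ∧ (a j ∨ b j) :=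
  hP.elim (fun h => ⟨Or.inl h.left, Or.inr h.right⟩) (fun h => ⟨Or.inr h.left, Or.inl h.right⟩)

/-- Every link has even length. -/
theorem even_of_link (H : NbrPair n a b) (hP : Link a b i j) : Even (j - i) := by
  by_contra hcon
  rw [Int.not_even_iff_odd] at hcon
  have hM : Mixed a b i j := Or.inl hP
  have hdisj := H.not_both hM hcon
  obtain ⟨k, l, hE, heven⟩ := H.exists_even_mixed hP hcon
  obtain ⟨t, h1, h2⟩ := H.exists_window i k
  have hE := H.mixed_add_mul t hE
  replace heven : Even (l + n * t - (k + n * t)) := by rwa [add_sub_add_right_eq_sub]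
  generalize k + n * t = k at h1 h2 hE heven
  generalize l + n * t = l at hE heven
  have hij : i < j := lt_of_le_of_ne hP.le fun h => by simp [h] at hcon
  have hkl : k < l := lt_of_le_of_ne hE.le fun h => by
    subst h
    exact hE.elim (fun h => hdisj _ ⟨h.left, h.right⟩) (fun h => hdisj _ ⟨h.right, h.left⟩)
  have hjk : j ≤ k := by
    by_contra hlt
    rcases eq_or_lt_of_le h1 with rfl | h3
    · have hl : l = j := by
        rcases lt_trichotomy l j with h | h | h
        · exact absurd (mem_ends hE).2 (not_or.2 (not_mem_interior hM hkl h))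
        · exact h
        · exact absurd (mem_ends hM).2 (not_or.2 (not_mem_interior hE hij h))
      subst hl
      exact Int.not_even_iff_odd.2 hcon heven
    · exact absurd (mem_ends hE).1 (not_or.2 (not_mem_interior hM h3 (by omega)))
  have hli : l ≤ i + n := by
    by_contra hlt
    exact (not_mem_interior hE h2 (by omega)).1 ((H.periodic_a i).2 hP.left)
  by_cases hk : k = j ∨ k = j + 1
  · exact H.false_of_touching hM hcon hE heven hk
  · by_cases hl : l = i + n ∨ l = i + n - 1
    · refine H.neg.false_of_touching (i := -(j + n)) (j := -(i + n)) (k := -l) (l := -k)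
        (H.mixed_shift hM).neg ?_ hE.neg ?_ (by omega)
      · convert hcon using 1; ring
      · convert heven using 1; ring
    · exact H.false_of_odd_of_even hM hE (by omega) (by omega) hcon heven

end NbrPair

end Links

section Nonadjacent

theorem Link.left_iff {a b : ℤ → Prop} {i : ℤ} {p : ℕ} (h : Link a b i (i + p)) (t : ℕ)
    (ht : t ≤ p) : a (i + t) ↔ t = 0 := by
  refine ⟨fun ha => ?_, fun h0 => by simpa [h0] using h.left⟩
  by_contra h0
  exact h.not_left _ (by omega) (by omega) ha

theorem Link.right_iff {a b : ℤ → Prop} {i : ℤ} {p : ℕ} (h : Link a b i (i + p)) (t : ℕ)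
    (ht : t ≤ p) : b (i + t) ↔ t = p := by
  refine ⟨fun hb => ?_, fun h0 => by simpa [h0] using h.right⟩
  by_contra h0
  exact h.not_right _ (by omega) (by omega) hb

theorem Mixed.exists_arc {a b : ℤ → Prop} {k l : ℤ} (h : Mixed a b k l) :
    ∃ (s ε : ℤ) (q : ℕ), (ε = 1 ∨ ε = -1) ∧ l = k + q ∧
      (∀ t : ℕ, t ≤ q → (a (s + ε * t) ↔ t = q)) ∧
      (∀ t : ℕ, t ≤ q → (b (s + ε * t) ↔ t = 0)) ∧
      ∀ t : ℕ, t ≤ q → k ≤ s + ε * t ∧ s + ε * t ≤ l := by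
  obtain ⟨q, rfl⟩ : ∃ q : ℕ, l = k + q := ⟨(l - k).toNat, by have := h.le; omega⟩
  rcases h with h | h
  · have back (t : ℕ) (ht : t ≤ q) : k + q + -1 * (t : ℤ) = k + (q - t : ℕ) := by omega
    refine ⟨k + q, -1, q, Or.inr rfl, rfl, ?_, ?_, ?_⟩ <;> intro t ht
    · rw [back t ht, h.left_iff _ (by omega)]; omega
    · rw [back t ht, h.right_iff _ (by omega)]; omega
    · omega
  · refine ⟨k, 1, q, Or.inl rfl, rfl, ?_, ?_, ?_⟩ <;> intro t ht
    · rw [one_mul, h.right_iff _ ht]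
    · rw [one_mul, h.left_iff _ ht]
    · omega

variable {G : SimpleGraph V} {n : ℕ} {F : ℤ → V} {x y : V}

theorem IntHole.le_of_links (hF : IntHole G n F) (hx : IntMajor G n F x)
    (hy : IntMajor G n F y) (hne : x ≠ y) (hxy : ¬ G.Adj x y) {i j k l : ℤ}
    (h : Link (fun t => G.Adj x (F t)) (fun t => G.Adj y (F t)) i j)
    (h' : Mixed (fun t => G.Adj x (F t)) (fun t => G.Adj y (F t)) k l)
    (hjk : j + 2 ≤ k) (hli : l + 2 ≤ i + n) (hodd : Odd (j - i + (l - k))) :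
    n ≤ j - i + (l - k) + 4 := by
  obtain ⟨p, rfl⟩ : ∃ p : ℕ, j = i + p := ⟨(j - i).toNat, by have := h.le; omega⟩
  obtain ⟨s, ε, q, hε, rfl, hQx, hQy, hfar⟩ := h'.exists_arc
  obtain ⟨g, hg⟩ := hF.exists_isHole_of_arcs hx hy hne hxy i s ε p q hε h.left_iff h.right_iff
    hQx hQy fun t ht => by have := hfar t ht; omega
  have hpq : Odd (p + q) := by
    have e : i + (p : ℤ) - i + (k + q - k) = ((p + q : ℕ) : ℤ) := by push_cast; ring
    rw [e] at hodd
    exact_mod_cast hodd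
  have := hF.shortest _ g ⟨hg, hpq.add_even (by decide)⟩
  omega

theorem IntHole.containsPyramid_of_links (hF : IntHole G n F) (hx : IntMajor G n F x)
    (hy : IntMajor G n F y) (hne : x ≠ y) (hxy : ¬ G.Adj x y) {i j k l : ℤ}
    (h : Mixed (fun t => G.Adj x (F t)) (fun t => G.Adj y (F t)) i j)
    (h' : Mixed (fun t => G.Adj x (F t)) (fun t => G.Adj y (F t)) k l) (hij : i < j)
    (hvx : G.Adj x (F (i - 1))) (hvy : G.Adj y (F (i - 1)))
    (hjk : j + 2 ≤ k) (hli : l + 3 ≤ i + n) : ContainsPyramid G := by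
  obtain ⟨p, rfl⟩ : ∃ p : ℕ, j = i + p := ⟨(j - i).toNat, by omega⟩
  rcases h with h | h
  · obtain ⟨s, ε, q, hε, rfl, hQx, hQy, hfar⟩ := h'.exists_arc
    exact hF.containsPyramid_of_arcs hx hy hne hxy i s ε p q hε (by omega) hvx hvy h.left_iff
      h.right_iff hQx hQy fun t ht => by have := hfar t ht; omega
  · obtain ⟨s, ε, q, hε, rfl, hQx, hQy, hfar⟩ := h'.swap.exists_arc
    exact hF.containsPyramid_of_arcs hy hx hne.symm (fun h => hxy h.symm) i s ε p q hε (by omega)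
      hvy hvx h.left_iff h.right_iff hQx hQy fun t ht => by have := hfar t ht; omega

theorem IntHole.nbrPair (hJ : ¬ ContainsJewel G) (hP : ¬ ContainsPyramid G)
    (hF : IntHole G n F) (hx : IntMajor G n F x) (hy : IntMajor G n F y) (hne : x ≠ y)
    (hxy : ¬ G.Adj x y) : NbrPair n (fun t => G.Adj x (F t)) (fun t => G.Adj y (F t)) where
  odd := hF.odd
  periodic_a i := by simp only [hF.periodic]
  periodic_b i := by simp only [hF.periodic]
  even_a := hx.even_gap hF
  even_b := hy.even_gap hF
  spread_a := hx.spread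
  spread_b := hy.spread
  three_a := hx.not_three hP hF
  three_b := hy.not_three hP hF
  four_a := hx.not_four hJ hF
  four_b := hy.not_four hJ hF
  hole i j k l h h' :=
    h.elim (fun h => hF.le_of_links hx hy hne hxy h h')
      (fun h => hF.le_of_links hy hx hne.symm (fun h => hxy h.symm) h h'.swap)
  pyramid_left i j k l h h' hij ha hb hjk hli :=
    hP (hF.containsPyramid_of_links hx hy hne hxy h h' hij ha hb hjk hli)
  pyramid_right i j k l h h' hij ha hb hjk hli := by
    have h'' : Mixed (fun t => G.Adj x (F t)) (fun t => G.Adj y (F t)) (k - n) (l - n) := by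
      refine h'.imp (fun h => h.shift ?_ ?_) (fun h => h.shift ?_ ?_) <;> intro i <;>
        simp only [← hF.periodic (i + -n), neg_add_cancel_right]
    refine hP (hF.neg.containsPyramid_of_links hx.neg hy.neg hne hxy h.neg h''.neg (by omega)
      ?_ ?_ (by omega) (by omega))
    · simpa [add_comm] using ha
    · simpa [add_comm] using hb

end Nonadjacent

section StableFamily

variable {G : SimpleGraph V} {n : ℕ} {f : ZMod n → V}

theorem intCast_eq_intCast_iff_of_lt {i j : ℤ} (h : i < j) (h' : j < i + 2 * n) :
    (i : ZMod n) = j ↔ j = i + n := by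
  rw [ZMod.intCast_eq_intCast_iff_dvd_sub]
  constructor
  · rintro ⟨c, hc⟩
    have h1 : 0 < c := by by_contra hcon; nlinarith
    have h2 : c < 2 := by by_contra hcon; nlinarith
    obtain rfl : c = 1 := by omega
    omega
  · rintro rfl
    simp

theorem IsShortestOddHole.intHole (h5 : ¬ ∃ g : ZMod 5 → V, IsHole G 5 g)
    (hC : IsShortestOddHole G n f) : IntHole G n (fun i => f i) := by
  obtain ⟨⟨⟨h4, hinj, hadj⟩, hodd⟩, hshort⟩ := hC
  have h7 : 7 ≤ n := by
    have : n ≠ 5 := by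
      rintro rfl
      exact h5 ⟨f, h4, hinj, hadj⟩
    obtain ⟨m, rfl⟩ := hodd
    omega
  refine ⟨h7, hodd, fun i => by simp, fun i j hij hj => ?_, fun i j hij hj h => ?_, hshort⟩
  · have e1 : (j : ZMod n) = i + 1 ↔ j = i + 1 := by
      rcases eq_or_lt_of_le (show i + 1 ≤ j by omega) with rfl | h
      · simp
      · rw [eq_comm, ← Int.cast_one, ← Int.cast_add, intCast_eq_intCast_iff_of_lt h (by omega)]
        omega
    have e2 : (i : ZMod n) = j + 1 ↔ j = i + n - 1 := by
      rw [← Int.cast_one, ← Int.cast_add, intCast_eq_intCast_iff_of_lt (by omega) (by omega)]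
      omega
    rw [hadj, e1, e2]
  · have := (intCast_eq_intCast_iff_of_lt hij (by omega)).1 (hinj h)
    omega

theorem IsCMajor.intMajor (hn : n ≠ 0) {x : V} (hx : IsCMajor G f x) :
    IntMajor G n (fun i => f i) x where
  notMem i h := hx.1 ⟨i, h⟩
  spread i := by
    have : NeZero n := ⟨hn⟩
    obtain ⟨j, hj, h1, h2, h3⟩ := hx.2 i
    have hlt : (j - (i - 1)).val < n := ZMod.val_lt _
    have e : (((i - 1 + (j - (i - 1)).val : ℤ)) : ZMod n) = j := by simp
    generalize (j - (i - 1)).val = d at hlt e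
    subst e
    refine ⟨i - 1 + d, ?_, by omega, hj⟩
    by_contra hcon
    obtain rfl | rfl | rfl : d = 0 ∨ d = 1 ∨ d = 2 := by omega
    · exact h1 (by simp)
    · exact h2 (by simp)
    · exact h3 (by push_cast; ring)

variable {F : ℤ → V} {S : Finset V}

/-- For pairwise nonadjacent major vertices, consecutive elements of the union of their
neighbourhoods on the hole are at even distance or are neighbours of a common vertex. -/
theorem IntHole.even_or_common (hJ : ¬ ContainsJewel G) (hP : ¬ ContainsPyramid G)
    (hF : IntHole G n F) (hS : ∀ s ∈ S, IntMajor G n F s)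
    (hstable : ∀ s ∈ S, ∀ t ∈ S, ¬ G.Adj s t) {i j : ℤ} (hij : i < j)
    (hi : ∃ s ∈ S, G.Adj s (F i)) (hj : ∃ s ∈ S, G.Adj s (F j))
    (hgap : ∀ k, i < k → k < j → ¬ ∃ s ∈ S, G.Adj s (F k)) :
    Even (j - i) ∨ ∃ s ∈ S, G.Adj s (F i) ∧ G.Adj s (F j) := by
  by_contra! hcon
  obtain ⟨s, hs, hsi⟩ := hi
  obtain ⟨t, ht, htj⟩ := hj
  have hst : s ≠ t := by
    rintro rfl
    exact hcon.2 s hs hsi htj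
  refine hcon.1 ?_
  refine (hF.nbrPair hJ hP (hS s hs) (hS t ht) hst (hstable s hs t ht)).even_of_link
    ⟨hij.le, hsi, htj, fun k h1 h2 hk => ?_, fun k h1 h2 hk => ?_⟩
  · rcases eq_or_lt_of_le h2 with rfl | h2
    · exact hcon.2 s hs hsi hk
    · exact hgap k h1 h2 ⟨s, hs, hk⟩
  · rcases eq_or_lt_of_le h1 with rfl | h1
    · exact hcon.2 t ht hk htj
    · exact hgap k h1 h2 ⟨t, ht, hk⟩

theorem IntHole.sum_prod_eq_zero (hJ : ¬ ContainsJewel G) (hP : ¬ ContainsPyramid G)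
    (hF : IntHole G n F) (hS : ∀ s ∈ S, IntMajor G n F s)
    (hstable : ∀ s ∈ S, ∀ t ∈ S, ¬ G.Adj s t) (hne : S.Nonempty) :
    ∑ t ∈ Finset.Ico 0 (0 + n : ℤ),
      ∏ s ∈ S, (1 + edgeInd (fun k => G.Adj s (F k)) t) = 0 := by
  set U : ℤ → Prop := fun k => ∃ s ∈ S, G.Adj s (F k) with hU
  have hprod (t : ℤ) : ∏ s ∈ S, (1 + edgeInd (fun k => G.Adj s (F k)) t) = 1 + edgeInd U t := by
    by_cases h : U t ∧ U (t + 1)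
    · obtain ⟨s, hs, h1⟩ : ∃ s ∈ S, G.Adj s (F t) ∧ G.Adj s (F (t + 1)) := by
        refine (hF.even_or_common hJ hP hS hstable (by omega) h.1 h.2
          (by omega)).resolve_left ?_
        simp
      rw [edgeInd_eq_one h.1 h.2, Finset.prod_eq_zero hs]
      · decide
      · rw [edgeInd_eq_one h1.1 h1.2]; decide
    · rw [edgeInd_eq_zero h, add_zero]
      refine Finset.prod_eq_one fun s hs => ?_
      rw [edgeInd_eq_zero fun h' => h ⟨⟨s, hs, h'.1⟩, ⟨s, hs, h'.2⟩⟩, add_zero]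
  obtain ⟨s, hs⟩ := hne
  obtain ⟨k, -, -, hk⟩ := (hS s hs).spread 0
  have hsum := sum_edgeInd_eq_one hF.odd (U := U) (by simp [hU, hF.periodic]) (by
    intro i j hij hi hj hgap
    rcases hF.even_or_common hJ hP hS hstable (by omega) hi hj hgap with h | ⟨s, hs, h1, h2⟩
    · exact h
    · exact (hS s hs).even_gap hF i j hij h1 h2 fun k hk hk' h => hgap k hk hk' ⟨s, hs, h⟩)
    ⟨k, s, hs, hk⟩ 0
  rw [Finset.sum_congr rfl fun t _ => hprod t, Finset.sum_add_distrib, hsum]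
  have : (n : ZMod 2) = 1 := (ZMod.natCast_eq_one_iff_odd).2 hF.odd
  simp [this]
  decide

/-- Pairwise nonadjacent major vertices have a common edge of the hole in their
neighbourhoods. -/
theorem IntHole.exists_common_edge (hJ : ¬ ContainsJewel G) (hP : ¬ ContainsPyramid G)
    (hF : IntHole G n F) (hS : ∀ s ∈ S, IntMajor G n F s)
    (hstable : ∀ s ∈ S, ∀ t ∈ S, ¬ G.Adj s t) :
    ∃ t : ℤ, ∀ s ∈ S, G.Adj s (F t) ∧ G.Adj s (F (t + 1)) := by
  classical
  have hn : (n : ZMod 2) = 1 := (ZMod.natCast_eq_one_iff_odd).2 hF.odd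
  have hsum : ∑ t ∈ Finset.Ico 0 (0 + n : ℤ),
      ∏ s ∈ S, edgeInd (fun k => G.Adj s (F k)) t = 1 := by
    have hexp (t : ℤ) : ∏ s ∈ S, edgeInd (fun k => G.Adj s (F k)) t =
        ∑ T ∈ S.powerset, ∏ s ∈ T, (1 + edgeInd (fun k => G.Adj s (F k)) t) := by
      rw [← Finset.prod_one_add]
      refine Finset.prod_congr rfl fun s _ => ?_
      rw [← add_assoc, show (1 : ZMod 2) + 1 = 0 by decide, zero_add]
    rw [Finset.sum_congr rfl fun t _ => hexp t, Finset.sum_comm,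
      Finset.sum_eq_single_of_mem ∅ (Finset.empty_mem_powerset S)]
    · simp [hn]
    · intro T hT hT'
      have hTS := Finset.mem_powerset.1 hT
      exact hF.sum_prod_eq_zero hJ hP (fun s hs => hS s (hTS hs))
        (fun s hs t ht => hstable s (hTS hs) t (hTS ht)) (Finset.nonempty_iff_ne_empty.2 hT')
  obtain ⟨t, -, ht⟩ := Finset.exists_ne_zero_of_sum_ne_zero (by rw [hsum]; decide)
  refine ⟨t, fun s hs => ?_⟩
  by_contra h
  exact ht (Finset.prod_eq_zero hs (edgeInd_eq_zero h))

end StableFamily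

section FiveHole

variable {G : SimpleGraph V} {n : ℕ} {F : ℤ → V}

theorem exists_isHole_five {v₀ v₁ v₂ v₃ v₄ : V} (h01 : G.Adj v₀ v₁) (h12 : G.Adj v₁ v₂)
    (h23 : G.Adj v₂ v₃) (h34 : G.Adj v₃ v₄) (h40 : G.Adj v₄ v₀) (h02 : ¬ G.Adj v₀ v₂)
    (h03 : ¬ G.Adj v₀ v₃) (h13 : ¬ G.Adj v₁ v₃) (h14 : ¬ G.Adj v₁ v₄) (h24 : ¬ G.Adj v₂ v₄) :
    ∃ g : ZMod 5 → V, IsHole G 5 g := by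
  have n02 : v₀ ≠ v₂ := by rintro rfl; exact h03 h23
  have n03 : v₀ ≠ v₃ := by rintro rfl; exact h13 h01.symm
  have n13 : v₁ ≠ v₃ := by rintro rfl; exact h03 h01
  have n14 : v₁ ≠ v₄ := by rintro rfl; exact h24 h12.symm
  have n24 : v₂ ≠ v₄ := by rintro rfl; exact h14 h12
  have := h40.symm
  refine ⟨_, isHole_of_seq (fun k => [v₀, v₁, v₂, v₃, v₄].getD k v₀) 5 (by norm_num) ?_ ?_⟩
  · intro i j hij hj
    interval_cases j <;> interval_cases i <;> simp [*, h01.ne, h12.ne, h23.ne, h34.ne, this.ne]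
  · intro i j hij hj
    interval_cases j <;> interval_cases i <;> simp [*]

/-- No vertex of the hole is equal or adjacent to both ends of an edge of the hole not
containing it. -/
theorem IntHole.exists_end_not_adj (hF : IntHole G n F) (t w : ℤ) (h : F w ≠ F t)
    (h' : F w ≠ F (t + 1)) : ¬ G.Adj (F t) (F w) ∨ ¬ G.Adj (F (t + 1)) (F w) := by
  have h7 := hF.seven
  have hper : Function.Periodic F n := hF.periodic
  have hw : F (t + (w - t) % n) = F w := by
    rw [show t + (w - t) % n = w - (w - t) / n * n by
      have := Int.emod_add_mul_ediv (w - t) n; linarith]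
    exact (hper.int_mul _).sub_eq w
  have h1 := Int.emod_nonneg (w - t) (show (n : ℤ) ≠ 0 by omega)
  have h2 := Int.emod_lt_of_pos (w - t) (show (0 : ℤ) < n by omega)
  rw [← hw] at h h' ⊢
  generalize (w - t) % n = d at *
  have h3 : d ≠ 0 := by rintro rfl; simp at h
  have h4 : d ≠ 1 := by rintro rfl; simp at h'
  rw [hF.adj _ _ (by omega) (by omega), hF.adj _ _ (by omega) (by omega)]
  omega

end FiveHole

/-- Let `G` contain no jewel, no pyramid and no hole of length five,
let `C` be a shortest odd hole in `G`, let `X` be a set of `C`-major vertices, and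
suppose some `x0 ∈ X` is nonadjacent to every other member of `X`. Then there is an
`X`-heavy edge in `C`. -/
theorem heavy_edge_exists {V : Type*} [Fintype V] (G : SimpleGraph V)
    (hJ : ¬ ContainsJewel G) (hP : ¬ ContainsPyramid G)
    (h5 : ¬ ∃ g : ZMod 5 → V, IsHole G 5 g)
    (n : ℕ) (f : ZMod n → V) (hC : IsShortestOddHole G n f)
    (X : Set V) (hXmaj : ∀ x ∈ X, IsCMajor G f x)
    (x0 : V) (hx0 : x0 ∈ X) (hx0nonadj : ∀ y ∈ X, y ≠ x0 → ¬ G.Adj x0 y) :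
    ∃ i : ZMod n, f i ∉ X ∧ f (i + 1) ∉ X ∧
      ∀ x ∈ X, G.Adj x (f i) ∨ G.Adj x (f (i + 1)) := by
  classical
  have hF := hC.intHole h5
  have h7 := hF.seven
  have hmaj (x : V) (hx : x ∈ X) := (hXmaj x hx).intMajor (by omega)
  have hx0nonadj' (y : V) (hy : y ∈ X) : ¬ G.Adj x0 y := by
    rcases eq_or_ne y x0 with rfl | h
    · simp
    · exact hx0nonadj y hy h
  set F : ℤ → V := fun i => f i with hFdef
  let A : V → Set ℤ := fun y => {t | G.Adj x0 (F t) ∧ G.Adj y (F t)}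
  let M : V → Prop := fun y => y ∈ X ∧ Minimal (· ∈ A '' X) (A y)
  let P : Finset V → Prop := fun T =>
    (∀ s ∈ T, s = x0 ∨ M s) ∧ ∀ s ∈ T, ∀ s' ∈ T, ¬ G.Adj s s'
  obtain ⟨S, hS0, hSmax⟩ : ∃ S, {x0} ≤ S ∧ Maximal P S :=
    Finite.exists_le_maximal ⟨by simp, by simp⟩
  have hx0S : x0 ∈ S := hS0 (Finset.mem_singleton_self x0)
  have hSX (s : V) (hs : s ∈ S) : s ∈ X := by
    rcases hSmax.prop.1 s hs with rfl | h
    exacts [hx0, h.1]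
  obtain ⟨t, ht⟩ := hF.exists_common_edge hJ hP (fun s hs => hmaj s (hSX s hs)) hSmax.prop.2
  have hoff (i : ZMod n) : f i ∉ X := fun h => (hXmaj _ h).1 ⟨i, rfl⟩
  refine ⟨t, hoff _, hoff _, fun x hx => ?_⟩
  have hcast : f ((t : ZMod n) + 1) = F (t + 1) := by simp [hFdef]
  rw [hcast]
  change G.Adj x (F t) ∨ _
  obtain ⟨_, hle, hmin⟩ := (X.toFinite.image A).exists_le_minimal ⟨x, hx, rfl⟩
  obtain ⟨y, hy, rfl⟩ := hmin.prop
  suffices h : G.Adj y (F t) ∨ G.Adj y (F (t + 1)) from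
    h.imp (fun h => (hle ⟨(ht x0 hx0S).1, h⟩).2) (fun h => (hle ⟨(ht x0 hx0S).2, h⟩).2)
  by_contra! hcon
  have hyS : y ∉ S := fun h => hcon.1 (ht y h).1
  obtain ⟨s, hs, hsy⟩ : ∃ s ∈ S, G.Adj s y := by
    by_contra! hno
    refine hyS (hSmax.le_of_ge (y := insert y S) ⟨?_, ?_⟩ (Finset.subset_insert y S)
      (Finset.mem_insert_self y S))
    · intro s hs
      rcases Finset.mem_insert.1 hs with rfl | hs
      exacts [Or.inr ⟨hy, hmin⟩, hSmax.prop.1 s hs]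
    · intro s hs s' hs'
      rcases Finset.mem_insert.1 hs with rfl | h <;> rcases Finset.mem_insert.1 hs' with rfl | h'
      exacts [G.loopless.irrefl _, fun e => hno s' h' e.symm, hno s h, hSmax.prop.2 s h s' h']
  have hsM : M s := (hSmax.prop.1 s hs).resolve_left (by
    rintro rfl
    exact hx0nonadj' y hy hsy)
  obtain ⟨w, ⟨hw0, hwy⟩, hws⟩ : ∃ w ∈ A y, w ∉ A s := by
    by_contra! h
    exact hcon.1 (hsM.2.le_of_le ⟨y, hy, rfl⟩ h ⟨(ht x0 hx0S).1, (ht s hs).1⟩).2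
  have hws' : ¬ G.Adj s (F w) := fun h => hws ⟨hw0, h⟩
  have five (z : ℤ) (h0 : G.Adj x0 (F z)) (h1 : G.Adj s (F z)) (h2 : ¬ G.Adj y (F z))
      (h3 : ¬ G.Adj (F z) (F w)) : False :=
    h5 (exists_isHole_five h0 h1.symm hsy hwy hw0.symm (hx0nonadj' s (hSX s hs))
      (hx0nonadj' y hy) (fun h => h2 h.symm) h3 hws')
  rcases hF.exists_end_not_adj t w (fun h => hcon.1 (h ▸ hwy))
    (fun h => hcon.2 (h ▸ hwy)) with h | h
  · exact five t (ht x0 hx0S).1 (ht s hs).1 hcon.1 h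
  · exact five (t + 1) (ht x0 hx0S).2 (ht s hs).2 hcon.2 h
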